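/- For every real ε > 0 there exists N such that for all integers n ≥ N there exist an integer k ≥ 1 and primes p, q, r satisfying n = k·p + r and r ≡ 1 (mod q), such that min{p²·k, p·k·r, q·r} ≥ n^(5/4 − ε). (Equivalently, the function f(n) defined below satisfies f(n) ≥ n^(5/4 − ε) for all sufficiently large n.) -/

import Mathlib

section

open Finset

/-- The additive character `e(t) = exp (2πit)`. -/
noncomputable def expChar (t : ℝ) : ℂ := Complex.exp (Complex.I * ((2 * Real.pi * t : ℝ) : ℂ))

lemma expChar_add (s t : ℝ) : expChar (s + t) = expChar s * expChar t := by
  rw [expChar, expChar, expChar, ← Complex.exp_add]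
  congr 1
  push_cast
  ring

lemma expChar_int (k : ℤ) : expChar k = 1 := by
  rw [expChar, Complex.exp_eq_one_iff]
  exact ⟨k, by push_cast; ring⟩

lemma expChar_zero : expChar 0 = 1 := by simpa using expChar_int 0

lemma conj_expChar (t : ℝ) : (starRingEnd ℂ) (expChar t) = expChar (-t) := by
  rw [expChar, expChar, ← Complex.exp_conj, map_mul, Complex.conj_I, Complex.conj_ofReal]
  congr 1
  push_cast
  ring

lemma norm_expChar (t : ℝ) : ‖expChar t‖ = 1 := by
  rw [expChar, mul_comm]
  exact Complex.norm_exp_ofReal_mul_I _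

lemma expChar_nat_mul (a : ℕ) (t : ℝ) : expChar (a * t) = expChar t ^ a := by
  rw [expChar, expChar, ← Complex.exp_nat_mul]
  congr 1
  push_cast
  ring

/-- Four times the distance of `t` to the nearest integer bounds `|e(t) - 1|` from below. -/
lemma le_norm_expChar_sub_one (t : ℝ) : 4 * |t - round t| ≤ ‖expChar t - 1‖ := by
  set u := t - round t with hu
  have h1 : expChar t = expChar u := by
    have : t = u + (round t : ℤ) := by rw [hu]; ring
    conv_lhs => rw [this]
    rw [expChar_add, expChar_int, mul_one]
  have hub : |u| ≤ 1 / 2 := abs_sub_round t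
  rw [h1, expChar, Complex.norm_exp_I_mul_ofReal_sub_one]
  have h2 : 2 * Real.pi * u / 2 = Real.pi * u := by ring
  rw [h2, norm_mul, Real.norm_eq_abs, Real.norm_eq_abs, abs_two]
  have hpi := Real.pi_pos
  have h3 : |Real.sin (Real.pi * u)| = |Real.sin (Real.pi * |u|)| := by
    rcases abs_cases u with ⟨h, _⟩ | ⟨h, _⟩ <;> rw [h]
    rw [mul_neg, Real.sin_neg, abs_neg]
  have h4 := Real.mul_le_sin (x := Real.pi * |u|) (by positivity) (by nlinarith)
  have h5 : 2 / Real.pi * (Real.pi * |u|) = 2 * |u| := by field_simp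
  rw [h5] at h4
  rw [h3]
  linarith [le_abs_self (Real.sin (Real.pi * |u|))]

lemma norm_geom_expChar_mul_le (n : ℕ) (t : ℝ) :
    ‖∑ a ∈ range n, expChar (a * t)‖ * (2 * |t - round t|) ≤ 1 := by
  have h1 : (∑ a ∈ range n, expChar (a * t)) * (expChar t - 1) = expChar t ^ n - 1 := by
    simp_rw [expChar_nat_mul]
    exact geom_sum_mul _ _
  have h2 : ‖expChar t ^ n - 1‖ ≤ 2 := by
    calc _ ≤ ‖expChar t ^ n‖ + ‖(1 : ℂ)‖ := norm_sub_le _ _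
      _ = 2 := by rw [norm_pow, norm_expChar]; norm_num
  have h3 := le_norm_expChar_sub_one t
  rw [← h1, norm_mul] at h2
  nlinarith [norm_nonneg (∑ a ∈ range n, expChar (a * t))]

lemma norm_geom_expChar_le (n : ℕ) (t : ℝ) : ‖∑ a ∈ range n, expChar (a * t)‖ ≤ n := by
  calc _ ≤ ∑ a ∈ range n, ‖expChar (a * t)‖ := norm_sum_le _ _
    _ = n := by simp [norm_expChar]

lemma sum_inv_sq_nat_le (s : Finset ℕ) (hs : ∀ n ∈ s, 0 < n) :
    ∑ n ∈ s, ((n : ℝ) ^ 2)⁻¹ ≤ 2 := by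
  obtain ⟨N, hN⟩ := s.exists_nat_subset_range
  have h1 : s ⊆ Ioc 0 (N + 1) := fun n hn => by
    have := mem_range.1 (hN hn)
    have := hs n hn
    simp; omega
  calc _ ≤ ∑ n ∈ Ioc 0 (N + 1), ((n : ℝ) ^ 2)⁻¹ :=
        sum_le_sum_of_subset_of_nonneg h1 fun _ _ _ => by positivity
    _ = 1 + ∑ n ∈ Ioc 1 (N + 1), ((n : ℝ) ^ 2)⁻¹ := by
        rw [← Finset.sum_Ioc_consecutive _ (Nat.zero_le 1) (by omega : 1 ≤ N + 1)]
        simp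
    _ ≤ 1 + 1 := by
        have := sum_Ioc_inv_sq_le_sub (α := ℝ) (k := 1) (n := N + 1) (by norm_num) (by omega)
        have h : (0 : ℝ) ≤ ((N + 1 : ℕ) : ℝ)⁻¹ := by positivity
        push_cast at *
        linarith
    _ = 2 := by norm_num

lemma sum_inv_sq_int_le (s : Finset ℤ) (hs : ∀ n ∈ s, n ≠ 0) :
    ∑ n ∈ s, ((n : ℝ) ^ 2)⁻¹ ≤ 4 := by
  have key : ∀ t : Finset ℤ, Set.InjOn Int.natAbs (t : Set ℤ) → (∀ n ∈ t, n ≠ 0) →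
      ∑ n ∈ t, ((n : ℝ) ^ 2)⁻¹ ≤ 2 := by
    intro t ht h0
    have h := sum_inv_sq_nat_le (t.image Int.natAbs) (by
      intro n hn
      obtain ⟨m, hm, rfl⟩ := mem_image.1 hn
      exact Int.natAbs_pos.2 (h0 m hm))
    rw [sum_image ht] at h
    refine le_trans (le_of_eq (sum_congr rfl fun n _ => ?_)) h
    rw [Nat.cast_natAbs, Int.cast_abs, sq_abs]
  rw [← sum_filter_add_sum_filter_not s (fun n => 0 < n)]
  have h1 := key (s.filter (fun n => 0 < n)) (by
    intro a ha b hb hab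
    simp at ha hb hab
    omega) (fun n hn => hs n (mem_filter.1 hn).1)
  have h2 := key (s.filter (fun n => ¬ 0 < n)) (by
    intro a ha b hb hab
    simp at ha hb hab
    omega) (fun n hn => hs n (mem_filter.1 hn).1)
  linarith

/-- The inverse squares of a `δ`-separated set of reals avoiding `(-δ, δ)` have a bounded sum. -/
lemma sum_inv_sq_le_of_separated {ι : Type*} (s : Finset ι) (u : ι → ℝ) {δ : ℝ} (hδ : 0 < δ)
    (h0 : ∀ i ∈ s, δ ≤ |u i|) (hs : ∀ i ∈ s, ∀ j ∈ s, i ≠ j → δ ≤ |u i - u j|) :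
    ∑ i ∈ s, (u i ^ 2)⁻¹ ≤ 16 / δ ^ 2 := by
  have hfl : ∀ i, (⌊u i / δ⌋ : ℝ) ≤ u i / δ ∧ u i / δ < ⌊u i / δ⌋ + 1 :=
    fun i => ⟨Int.floor_le _, Int.lt_floor_add_one _⟩
  have hne : ∀ i ∈ s, ⌊u i / δ⌋ ≠ 0 := by
    intro i hi h
    have := hfl i
    rw [h] at this
    have h1 := h0 i hi
    rw [le_div_iff₀ hδ, div_lt_iff₀ hδ] at this
    push_cast at this
    have h2 : |u i| < δ := abs_lt.2 ⟨by linarith, by linarith⟩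
    linarith
  have hinj : Set.InjOn (fun i => ⌊u i / δ⌋) (s : Set ι) := by
    intro i hi j hj hij
    by_contra hne
    have h1 := hs i hi j hj hne
    have h2 := hfl i
    have h3 := hfl j
    simp only at hij
    rw [hij] at h2
    rw [le_div_iff₀ hδ, div_lt_iff₀ hδ] at h2 h3
    have : |u i - u j| < δ := abs_lt.2 ⟨by linarith, by linarith⟩
    linarith
  have hb : ∀ i ∈ s, (u i ^ 2)⁻¹ ≤ 4 / δ ^ 2 * (((⌊u i / δ⌋ : ℤ) : ℝ) ^ 2)⁻¹ := by
    intro i hi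
    have hn : (⌊u i / δ⌋ : ℝ) ≠ 0 := by exact_mod_cast hne i hi
    have h1 := h0 i hi
    have h2 := hfl i
    have h3 : |(⌊u i / δ⌋ : ℝ)| ≤ 2 * (|u i| / δ) := by
      have h4 : 1 ≤ |u i| / δ := (one_le_div hδ).2 h1
      have h5 : |u i / δ| = |u i| / δ := by rw [abs_div, abs_of_pos hδ]
      have h6 := abs_le.1 (le_of_eq h5)
      exact abs_le.2 ⟨by linarith, by linarith⟩
    have h4 : δ * |(⌊u i / δ⌋ : ℝ)| ≤ 2 * |u i| := by
      have := mul_le_mul_of_nonneg_left h3 hδ.le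
      calc _ ≤ _ := this
        _ = _ := by field_simp
    have h5 : (δ * |(⌊u i / δ⌋ : ℝ)|) ^ 2 ≤ (2 * |u i|) ^ 2 :=
      pow_le_pow_left₀ (by positivity) h4 2
    rw [mul_pow, mul_pow, sq_abs, sq_abs] at h5
    have hu : 0 < u i ^ 2 := by rw [← sq_abs]; have := hδ.trans_le h1; positivity
    have hnn : 0 < (⌊u i / δ⌋ : ℝ) ^ 2 := by positivity
    rw [← div_eq_mul_inv, div_div, le_div_iff₀ (by positivity), inv_mul_le_iff₀ hu]
    linarith
  calc _ ≤ ∑ i ∈ s, 4 / δ ^ 2 * (((⌊u i / δ⌋ : ℤ) : ℝ) ^ 2)⁻¹ := sum_le_sum hb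
    _ = 4 / δ ^ 2 * ∑ n ∈ s.image (fun i => ⌊u i / δ⌋), ((n : ℝ) ^ 2)⁻¹ := by
        rw [mul_sum, sum_image hinj, ]
    _ ≤ 4 / δ ^ 2 * 4 := by
        gcongr
        refine sum_inv_sq_int_le _ fun n hn => ?_
        obtain ⟨i, hi, rfl⟩ := mem_image.1 hn
        exact hne i hi
    _ ≤ 16 / δ ^ 2 := by
        rw [div_mul_eq_mul_div]; gcongr; norm_num

lemma sum_sq_norm_geom_le {ι : Type*} [DecidableEq ι] (s : Finset ι) (α : ι → ℝ) {N : ℕ} {δ : ℝ}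
    (hδ : 0 < δ) (hN : 1 / δ ≤ N)
    (hs : ∀ i ∈ s, ∀ j ∈ s, i ≠ j → ∀ k : ℤ, δ ≤ |α i - α j - k|) (i : ι) (hi : i ∈ s) :
    ∑ j ∈ s, ‖∑ a ∈ range (2 * N), expChar (a * (α i - α j))‖ ^ 2 ≤ 8 * (N : ℝ) ^ 2 := by
  rw [← add_sum_erase s _ hi]
  have h1 : ‖∑ a ∈ range (2 * N), expChar (a * (α i - α i))‖ ^ 2 ≤ 4 * (N : ℝ) ^ 2 := by
    have := pow_le_pow_left₀ (norm_nonneg _) (norm_geom_expChar_le (2 * N) (α i - α i)) 2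
    push_cast at this
    nlinarith
  set u : ι → ℝ := fun j => (α i - α j) - round (α i - α j) with hu
  have hu0 : ∀ j ∈ s.erase i, δ ≤ |u j| := fun j hj =>
    hs i hi j (mem_of_mem_erase hj) (ne_of_mem_erase hj).symm _
  have h2 : ∑ j ∈ s.erase i, ‖∑ a ∈ range (2 * N), expChar (a * (α i - α j))‖ ^ 2 ≤
      ∑ j ∈ s.erase i, 1 / 4 * (u j ^ 2)⁻¹ := by
    refine sum_le_sum fun j hj => ?_
    have h := norm_geom_expChar_mul_le (2 * N) (α i - α j)
    have hpos : 0 < |u j| := hδ.trans_le (hu0 j hj)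
    have hsq : 0 < u j ^ 2 := by rw [← sq_abs]; positivity
    have h' := pow_le_pow_left₀ (by positivity) h 2
    rw [mul_pow, mul_pow, sq_abs] at h'
    rw [← div_eq_mul_inv, le_div_iff₀ hsq]
    simp only [hu] at *
    linarith
  have h3 := sum_inv_sq_le_of_separated (s.erase i) u hδ hu0 (by
    intro j hj k hk hjk
    have := hs k (mem_of_mem_erase hk) j (mem_of_mem_erase hj) hjk.symm
      (round (α i - α j) - round (α i - α k))
    refine this.trans (le_of_eq ?_)
    simp only [hu]
    congr 1
    push_cast
    ring)
  rw [← mul_sum] at h2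
  have h4 : 1 / δ ^ 2 ≤ (N : ℝ) ^ 2 := by
    have := pow_le_pow_left₀ (by positivity) hN 2
    simpa [div_pow] using this
  have h5 : 16 / δ ^ 2 = 16 * (1 / δ ^ 2) := by ring
  linarith

lemma sum_sq_norm_le_sum_sub {N : ℕ} (G : ℝ → ℂ) :
    N * ∑ m ∈ range N, ‖G m‖ ^ 2 ≤
      ∑ b ∈ range (2 * N), ∑ a ∈ range (2 * N), ‖G ((a : ℝ) - b)‖ ^ 2 := by
  calc (N : ℝ) * ∑ m ∈ range N, ‖G m‖ ^ 2
      = ∑ b ∈ range N, ∑ m ∈ range N, ‖G m‖ ^ 2 := by simp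
    _ = ∑ b ∈ range N, ∑ a ∈ Ico b (b + N), ‖G ((a : ℝ) - b)‖ ^ 2 := by
        refine sum_congr rfl fun b _ => ?_
        rw [sum_Ico_eq_sum_range]
        simp
    _ ≤ ∑ b ∈ range N, ∑ a ∈ range (2 * N), ‖G ((a : ℝ) - b)‖ ^ 2 := by
        refine sum_le_sum fun b hb => sum_le_sum_of_subset_of_nonneg ?_ fun _ _ _ => by positivity
        intro a ha
        simp at *
        omega
    _ ≤ _ := by
        refine sum_le_sum_of_subset_of_nonneg ?_
          fun _ _ _ => sum_nonneg fun _ _ => by positivity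
        intro a ha
        simp at *
        omega

/-- The dual large sieve inequality. -/
lemma dual_large_sieve {ι : Type*} (s : Finset ι) (α : ι → ℝ) {N : ℕ} {δ : ℝ}
    (hδ : 0 < δ) (hN : 1 / δ ≤ N)
    (hs : ∀ i ∈ s, ∀ j ∈ s, i ≠ j → ∀ k : ℤ, δ ≤ |α i - α j - k|) (c : ι → ℂ) :
    ∑ m ∈ range N, ‖∑ i ∈ s, c i * expChar (m * α i)‖ ^ 2 ≤ 8 * N * ∑ i ∈ s, ‖c i‖ ^ 2 := by
  classical
  have hNpos : (0 : ℝ) < N := lt_of_lt_of_le (by positivity) hN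
  set G : ℝ → ℂ := fun t => ∑ i ∈ s, c i * expChar (t * α i) with hG
  set D : ι → ι → ℂ := fun i j => ∑ a ∈ range (2 * N), expChar (a * (α i - α j)) with hD
  have h1 := sum_sq_norm_le_sum_sub (N := N) G
  have h2 : ((∑ b ∈ range (2 * N), ∑ a ∈ range (2 * N), ‖G ((a : ℝ) - b)‖ ^ 2 : ℝ) : ℂ) =
      ∑ i ∈ s, ∑ j ∈ s, c i * (starRingEnd ℂ) (c j) * ((‖D i j‖ ^ 2 : ℝ) : ℂ) := by
    have hsq : ∀ z : ℂ, ((‖z‖ ^ 2 : ℝ) : ℂ) = z * (starRingEnd ℂ) z := fun z => by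
      rw [Complex.mul_conj, Complex.normSq_eq_norm_sq]
    push_cast
    have e1 : ∀ a b : ℕ, (‖G ((a : ℝ) - b)‖ : ℂ) ^ 2 = ∑ i ∈ s, ∑ j ∈ s,
        c i * (starRingEnd ℂ) (c j) *
          (expChar (a * (α i - α j)) * (starRingEnd ℂ) (expChar (b * (α i - α j)))) := by
      intro a b
      have := hsq (G ((a : ℝ) - b))
      push_cast at this
      rw [this, hG]
      simp only [map_sum, map_mul, sum_mul_sum, conj_expChar]
      refine sum_congr rfl fun i _ => sum_congr rfl fun j _ => ?_
      rw [← expChar_add, mul_mul_mul_comm, ← expChar_add]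
      congr 2
      ring
    have e2 : ∀ i j : ι, (‖D i j‖ : ℂ) ^ 2 = ∑ b ∈ range (2 * N), ∑ a ∈ range (2 * N),
          (expChar (a * (α i - α j)) * (starRingEnd ℂ) (expChar (b * (α i - α j)))) := by
      intro i j
      have := hsq (D i j)
      push_cast at this
      rw [this, hD, map_sum, sum_mul_sum, sum_comm]
    simp_rw [e1, e2, mul_sum]
    have e3 : ∀ F : ℕ → ℕ → ι → ι → ℂ,
        ∑ b ∈ range (2 * N), ∑ a ∈ range (2 * N), ∑ i ∈ s, ∑ j ∈ s, F b a i j =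
        ∑ i ∈ s, ∑ j ∈ s, ∑ b ∈ range (2 * N), ∑ a ∈ range (2 * N), F b a i j := by
      intro F
      rw [sum_congr rfl fun b _ => sum_comm, sum_comm]
      refine sum_congr rfl fun i _ => ?_
      rw [sum_congr rfl fun b _ => sum_comm, sum_comm]
    exact e3 _
  have h3 : ∑ b ∈ range (2 * N), ∑ a ∈ range (2 * N), ‖G ((a : ℝ) - b)‖ ^ 2 ≤
      ∑ i ∈ s, ∑ j ∈ s, (‖c i‖ ^ 2 / 2 * ‖D i j‖ ^ 2 + ‖c j‖ ^ 2 / 2 * ‖D i j‖ ^ 2) := by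
    have hnn : (0 : ℝ) ≤ ∑ b ∈ range (2 * N), ∑ a ∈ range (2 * N), ‖G ((a : ℝ) - b)‖ ^ 2 :=
      sum_nonneg fun _ _ => sum_nonneg fun _ _ => by positivity
    have := congrArg norm h2
    rw [Complex.norm_real, Real.norm_of_nonneg hnn] at this
    rw [this]
    refine (norm_sum_le _ _).trans (sum_le_sum fun i _ => (norm_sum_le _ _).trans
      (sum_le_sum fun j _ => ?_))
    rw [norm_mul, norm_mul, Complex.norm_real, Real.norm_of_nonneg (by positivity),
      RCLike.norm_conj]
    nlinarith [mul_nonneg (sq_nonneg (‖c i‖ - ‖c j‖)) (sq_nonneg ‖D i j‖)]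
  have h4 : ∑ i ∈ s, ∑ j ∈ s, ‖c i‖ ^ 2 / 2 * ‖D i j‖ ^ 2 ≤
      ∑ i ∈ s, ‖c i‖ ^ 2 / 2 * (8 * (N : ℝ) ^ 2) := by
    refine sum_le_sum fun i hi => ?_
    rw [← mul_sum]
    exact mul_le_mul_of_nonneg_left (sum_sq_norm_geom_le s α hδ hN hs i hi) (by positivity)
  have h5 : ∑ i ∈ s, ∑ j ∈ s, ‖c j‖ ^ 2 / 2 * ‖D i j‖ ^ 2 ≤
      ∑ j ∈ s, ‖c j‖ ^ 2 / 2 * (8 * (N : ℝ) ^ 2) := by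
    rw [sum_comm]
    refine sum_le_sum fun j hj => ?_
    rw [← mul_sum]
    refine mul_le_mul_of_nonneg_left ?_ (by positivity)
    have := sum_sq_norm_geom_le s (fun i => -α i) hδ hN (by
      intro i hi k hk hik m
      refine (hs i hi k hk hik (-m)).trans (le_of_eq ?_)
      rw [← abs_neg]
      congr 1
      push_cast
      ring) j hj
    refine le_trans (le_of_eq (sum_congr rfl fun i _ => ?_)) this
    simp only [hD]
    congr 2
    refine sum_congr rfl fun a _ => ?_
    congr 1
    ring
  simp_rw [sum_add_distrib] at h3
  rw [← sum_mul, ← sum_div] at h4 h5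
  have h6 : (N : ℝ) * ∑ m ∈ range N, ‖G m‖ ^ 2 ≤ N * (8 * N * ∑ i ∈ s, ‖c i‖ ^ 2) := by
    refine h1.trans (h3.trans ((add_le_add h4 h5).trans (le_of_eq ?_)))
    ring
  exact le_of_mul_le_mul_left h6 hNpos

/-- The large sieve inequality for well-spaced points modulo `1`. -/
lemma large_sieve {ι : Type*} (s : Finset ι) (α : ι → ℝ) {N : ℕ} {δ : ℝ}
    (hδ : 0 < δ) (hN : 1 / δ ≤ N)
    (hs : ∀ i ∈ s, ∀ j ∈ s, i ≠ j → ∀ k : ℤ, δ ≤ |α i - α j - k|) (f : ℕ → ℝ) :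
    ∑ i ∈ s, ‖∑ m ∈ range N, (f m : ℂ) * expChar (m * α i)‖ ^ 2 ≤
      8 * N * ∑ m ∈ range N, f m ^ 2 := by
  set S : ι → ℂ := fun i => ∑ m ∈ range N, (f m : ℂ) * expChar (m * α i) with hS
  set X : ℝ := ∑ i ∈ s, ‖S i‖ ^ 2 with hX
  set A : ℝ := ∑ m ∈ range N, f m ^ 2 with hA
  set T : ℕ → ℂ := fun m => ∑ i ∈ s, (starRingEnd ℂ) (S i) * expChar (m * α i) with hT
  have hX0 : 0 ≤ X := sum_nonneg fun _ _ => by positivity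
  have hA0 : 0 ≤ A := sum_nonneg fun _ _ => by positivity
  have h1 : (X : ℂ) = ∑ m ∈ range N, (f m : ℂ) * T m := by
    simp_rw [hX, hT, mul_sum]
    rw [sum_comm]
    push_cast
    refine sum_congr rfl fun i _ => ?_
    rw [← Complex.ofReal_pow, ← Complex.normSq_eq_norm_sq, ← Complex.mul_conj]
    conv_lhs => rw [hS]
    simp only [sum_mul]
    refine sum_congr rfl fun m _ => ?_
    ring
  have h2 : X ≤ ∑ m ∈ range N, |f m| * ‖T m‖ := by
    have := congrArg norm h1
    rw [Complex.norm_real, Real.norm_of_nonneg hX0] at this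
    rw [this]
    refine (norm_sum_le _ _).trans (le_of_eq (sum_congr rfl fun m _ => ?_))
    rw [norm_mul, Complex.norm_real, Real.norm_eq_abs]
  have h3 : X ^ 2 ≤ A * (8 * N * X) := by
    calc X ^ 2 ≤ (∑ m ∈ range N, |f m| * ‖T m‖) ^ 2 := pow_le_pow_left₀ hX0 h2 2
      _ ≤ (∑ m ∈ range N, |f m| ^ 2) * ∑ m ∈ range N, ‖T m‖ ^ 2 :=
          sum_mul_sq_le_sq_mul_sq _ _ _
      _ ≤ A * (8 * N * X) := by
          simp_rw [sq_abs]
          refine mul_le_mul_of_nonneg_left ?_ hA0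
          refine (dual_large_sieve s α hδ hN hs _).trans (le_of_eq ?_)
          simp [hX]
  rcases hX0.eq_or_lt with h | h
  · rw [← h]; positivity
  · nlinarith

/-- The sum over reduced fractions `b / d` of `|∑_{m < N} f(m) e(mb/d)|²`. -/
noncomputable def reducedSum (f : ℕ → ℝ) (N d : ℕ) : ℝ :=
  ∑ b ∈ range d with b.Coprime d,
    ‖∑ m ∈ range N, (f m : ℂ) * expChar (m * ((b : ℝ) / d))‖ ^ 2

lemma reducedSum_nonneg (f : ℕ → ℝ) (N d : ℕ) : 0 ≤ reducedSum f N d :=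
  sum_nonneg fun _ _ => by positivity

lemma farey_separated {Z d e a b : ℕ} (hd : 1 ≤ d) (hdZ : d ≤ Z) (he : 1 ≤ e) (heZ : e ≤ Z)
    (had : a < d) (hbe : b < e) (hac : a.Coprime d) (hbc : b.Coprime e)
    (hne : ¬ (d = e ∧ a = b)) (k : ℤ) :
    1 / (Z : ℝ) ^ 2 ≤ |(a : ℝ) / d - (b : ℝ) / e - k| := by
  have hd0 : (0 : ℝ) < d := by exact_mod_cast hd
  have he0 : (0 : ℝ) < e := by exact_mod_cast he
  have h1 : (a : ℝ) / d - (b : ℝ) / e - k = ((a * e - b * d - k * d * e : ℤ) : ℝ) / (d * e) := by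
    push_cast
    field_simp
  have h2 : (a * e - b * d - k * d * e : ℤ) ≠ 0 := by
    intro h
    have hde : d ∣ e := by
      have : (d : ℤ) ∣ a * e := ⟨b + k * e, by linarith⟩
      have : d ∣ a * e := by exact_mod_cast this
      exact hac.symm.dvd_of_dvd_mul_left this
    have hed : e ∣ d := by
      have : (e : ℤ) ∣ b * d := ⟨a - k * d, by linarith⟩
      have : e ∣ b * d := by exact_mod_cast this
      exact hbc.symm.dvd_of_dvd_mul_left this
    have hh := Nat.dvd_antisymm hde hed
    subst hh
    refine hne ⟨rfl, ?_⟩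
    have h3 : ((a : ℤ) - b - k * d) * d = 0 := by linarith
    have h4 : (a : ℤ) - b - k * d = 0 := by
      rcases mul_eq_zero.1 h3 with h | h
      · exact h
      · omega
    have h5 : (d : ℤ) ∣ a - b := ⟨k, by linarith⟩
    have h6 : (a : ℤ) - b = 0 := Int.eq_zero_of_abs_lt_dvd h5 (by rw [abs_lt]; omega)
    omega
  have h3 : (1 : ℝ) ≤ |((a * e - b * d - k * d * e : ℤ) : ℝ)| := by
    exact_mod_cast Int.one_le_abs h2
  rw [h1, abs_div, abs_of_pos (mul_pos hd0 he0)]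
  have h4 : (d : ℝ) * e ≤ (Z : ℝ) ^ 2 := by
    rw [sq]; exact_mod_cast Nat.mul_le_mul hdZ heZ
  gcongr

/-- The large sieve inequality for Farey fractions. -/
lemma sum_reducedSum_le (f : ℕ → ℝ) (N : ℕ) {Z : ℕ} (hZ : 1 ≤ Z) :
    ∑ d ∈ Icc 1 Z, reducedSum f N d ≤ 8 * (N + (Z : ℝ) ^ 2) * ∑ m ∈ range N, f m ^ 2 := by
  have hZ0 : (0 : ℝ) < Z := by exact_mod_cast hZ
  have h := large_sieve ((Icc 1 Z).sigma fun d => (range d).filter fun b => b.Coprime d)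
    (fun x => (x.2 : ℝ) / x.1) (N := N + Z ^ 2) (δ := 1 / (Z : ℝ) ^ 2) (by positivity)
    (by push_cast; rw [one_div_one_div]; linarith [(Nat.cast_nonneg N : (0 : ℝ) ≤ N)])
    (by
      rintro ⟨d, a⟩ hi ⟨e, b⟩ hj hij k
      simp only [mem_sigma, mem_Icc, mem_filter, mem_range] at hi hj
      refine farey_separated hi.1.1 hi.1.2 hj.1.1 hj.1.2 hi.2.1 hj.2.1 hi.2.2 hj.2.2 ?_ k
      rintro ⟨rfl, rfl⟩
      exact hij rfl)
    (fun m => if m < N then f m else 0)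
  have hsub : range N ⊆ range (N + Z ^ 2) := range_subset_range.2 (by omega)
  rw [sum_sigma] at h
  have e1 : ∑ m ∈ range (N + Z ^ 2), (if m < N then f m else 0) ^ 2 = ∑ m ∈ range N, f m ^ 2 := by
    rw [← sum_subset hsub]
    · exact sum_congr rfl fun m hm => by rw [if_pos (mem_range.1 hm)]
    · intro m _ hm
      rw [if_neg (by simpa using hm)]
      simp
  have e2 : ∀ t : ℝ, ∑ m ∈ range (N + Z ^ 2),
      (((if m < N then f m else 0 : ℝ)) : ℂ) * expChar (m * t) =
      ∑ m ∈ range N, (f m : ℂ) * expChar (m * t) := by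
    intro t
    rw [← sum_subset hsub]
    · exact sum_congr rfl fun m hm => by rw [if_pos (mem_range.1 hm)]
    · intro m _ hm
      rw [if_neg (by simpa using hm)]
      simp
  simp only [e1, e2] at h
  push_cast at h
  exact h

lemma sum_expChar_div {D : ℕ} (hD : 0 < D) (m n : ℕ) :
    ∑ b ∈ range D, expChar (b * (((m : ℝ) - n) / D)) =
      if (m : ZMod D) = n then (D : ℂ) else 0 := by
  have hD0 : (D : ℝ) ≠ 0 := by positivity
  have : NeZero D := ⟨hD.ne'⟩
  have hiff : (m : ZMod D) = n ↔ (D : ℤ) ∣ (m : ℤ) - n := by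
    rw [← ZMod.intCast_zmod_eq_zero_iff_dvd]
    push_cast
    exact sub_eq_zero.symm
  split_ifs with h
  · obtain ⟨k, hk⟩ := hiff.1 h
    have : ((m : ℝ) - n) / D = k := by
      have : ((m : ℝ) - n) = D * k := by exact_mod_cast hk
      rw [this]; field_simp
    rw [this]
    have : ∀ b ∈ range D, expChar ((b : ℝ) * (k : ℤ)) = 1 := fun b _ => by
      have := expChar_int (b * k)
      push_cast at this
      exact this
    rw [sum_congr rfl this]
    simp
  · set t : ℝ := ((m : ℝ) - n) / D with ht
    have h1 : (∑ b ∈ range D, expChar (b * t)) * (expChar t - 1) = expChar t ^ D - 1 := by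
      simp_rw [expChar_nat_mul]
      exact geom_sum_mul _ _
    have h2 : expChar t ^ D = 1 := by
      rw [← expChar_nat_mul, ht, mul_div_cancel₀ _ hD0]
      have := expChar_int (m - n)
      push_cast at this
      exact this
    rw [h2, sub_self] at h1
    rcases mul_eq_zero.1 h1 with h3 | h3
    · exact h3
    · exfalso
      have h4 := le_norm_expChar_sub_one t
      rw [h3, norm_zero] at h4
      have h5 : t - round t = 0 := abs_eq_zero.1 (le_antisymm (by linarith) (abs_nonneg _))
      apply h
      rw [hiff]
      refine ⟨round t, ?_⟩
      have h6 : (m : ℝ) - n = D * (round t : ℤ) := by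
        rw [← sub_eq_zero.1 h5, ht]; field_simp
      exact_mod_cast h6

/-- The sum of `f` over a residue class, up to `N`. -/
noncomputable def classSum (f : ℕ → ℝ) (N : ℕ) {D : ℕ} (a : ZMod D) : ℝ :=
  ∑ m ∈ range N, if (m : ZMod D) = a then f m else 0

lemma sum_classSum (f : ℕ → ℝ) (N D : ℕ) [NeZero D] :
    ∑ a : ZMod D, classSum f N a = ∑ m ∈ range N, f m := by
  simp_rw [classSum]
  rw [sum_comm]
  simp

lemma sum_sq_norm_expSum (f : ℕ → ℝ) (N D : ℕ) [NeZero D] :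
    ∑ b ∈ range D, ‖∑ m ∈ range N, (f m : ℂ) * expChar (m * ((b : ℝ) / D))‖ ^ 2 =
      D * ∑ a : ZMod D, classSum f N a ^ 2 := by
  have hR : (D : ℝ) * ∑ a : ZMod D, classSum f N a ^ 2 =
      ∑ m ∈ range N, ∑ n ∈ range N, f m * f n * (if (m : ZMod D) = n then (D : ℝ) else 0) := by
    simp_rw [classSum, sq, sum_mul_sum]
    rw [sum_comm, mul_sum]
    refine sum_congr rfl fun m _ => ?_
    rw [sum_comm, mul_sum]
    refine sum_congr rfl fun n _ => ?_
    have : ∀ a : ZMod D, ((if (m : ZMod D) = a then f m else 0) *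
        if (n : ZMod D) = a then f n else 0) =
        if (m : ZMod D) = a then (f m * if (n : ZMod D) = m then f n else 0) else 0 := by
      intro a
      by_cases h : (m : ZMod D) = a
      · subst h; simp
      · simp [h]
    simp_rw [this]
    rw [sum_ite_eq]
    by_cases h : (m : ZMod D) = n
    · simp [h]; ring
    · simp [h, Ne.symm h]
  have hL : ((∑ b ∈ range D,
      ‖∑ m ∈ range N, (f m : ℂ) * expChar (m * ((b : ℝ) / D))‖ ^ 2 : ℝ) : ℂ) =
      ((∑ m ∈ range N, ∑ n ∈ range N,
        f m * f n * (if (m : ZMod D) = n then (D : ℝ) else 0) : ℝ) : ℂ) := by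
    push_cast
    have e1 : ∀ b : ℕ, (‖∑ m ∈ range N, (f m : ℂ) * expChar (m * ((b : ℝ) / D))‖ : ℂ) ^ 2 =
        ∑ m ∈ range N, ∑ n ∈ range N,
          (f m : ℂ) * f n * expChar (b * (((m : ℝ) - n) / D)) := by
      intro b
      rw [← Complex.ofReal_pow, ← Complex.normSq_eq_norm_sq, ← Complex.mul_conj, map_sum,
        sum_mul_sum]
      refine sum_congr rfl fun m _ => sum_congr rfl fun n _ => ?_
      rw [map_mul, Complex.conj_ofReal, conj_expChar, mul_mul_mul_comm, ← expChar_add]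
      congr 2
      ring
    simp_rw [e1]
    rw [sum_comm]
    refine sum_congr rfl fun m _ => ?_
    rw [sum_comm]
    refine sum_congr rfl fun n _ => ?_
    rw [← mul_sum, sum_expChar_div (NeZero.pos D)]
    split_ifs <;> simp
  rw [hR]
  exact_mod_cast hL

/-- The mean over reduced residue classes of the sums of `f`. -/
noncomputable def unitMean (f : ℕ → ℝ) (N D : ℕ) [NeZero D] : ℝ :=
  (∑ u : (ZMod D)ˣ, classSum f N (u : ZMod D)) / D.totient

/-- The variance over reduced residue classes of the sums of `f`. -/
noncomputable def unitVariance (f : ℕ → ℝ) (N D : ℕ) [NeZero D] : ℝ :=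
  ∑ u : (ZMod D)ˣ, (classSum f N (u : ZMod D) - unitMean f N D) ^ 2

lemma unitVariance_nonneg (f : ℕ → ℝ) (N D : ℕ) [NeZero D] : 0 ≤ unitVariance f N D :=
  sum_nonneg fun _ _ => by positivity

lemma mul_unitVariance_le (f : ℕ → ℝ) (N D : ℕ) [NeZero D] :
    D * unitVariance f N D ≤ ∑ b ∈ (range D).erase 0,
      ‖∑ m ∈ range N, (f m : ℂ) * expChar (m * ((b : ℝ) / D))‖ ^ 2 := by
  have hD : 0 < D := NeZero.pos D
  have hD0 : (0 : ℝ) < D := by exact_mod_cast hD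
  have hφ : (0 : ℝ) < D.totient := by exact_mod_cast Nat.totient_pos.2 hD
  set W : ℝ := ∑ m ∈ range N, f m with hW
  set z : ZMod D → ℝ := fun a => classSum f N a with hz
  have h1 : unitVariance f N D ≤ ∑ u : (ZMod D)ˣ, (z u - W / D) ^ 2 := by
    set μ := unitMean f N D with hμ
    have hs : ∑ u : (ZMod D)ˣ, z u = D.totient * μ := by
      rw [hμ, unitMean]; field_simp; rfl
    have hc : ((Finset.univ : Finset (ZMod D)ˣ).card : ℝ) = D.totient := by
      rw [Finset.card_univ, ZMod.card_units_eq_totient]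
    have : ∑ u : (ZMod D)ˣ, (z u - W / D) ^ 2 - unitVariance f N D =
        D.totient * (μ - W / D) ^ 2 := by
      rw [unitVariance, ← sum_sub_distrib]
      have : ∀ u : (ZMod D)ˣ, (z u - W / D) ^ 2 - (classSum f N (u : ZMod D) - μ) ^ 2 =
          2 * (μ - W / D) * z u + ((W / D) ^ 2 - μ ^ 2) := fun u => by
        simp only [hz]; ring
      simp_rw [← hμ, this, sum_add_distrib, ← mul_sum, hs, sum_const, nsmul_eq_mul, hc]
      ring
    have h0 : 0 ≤ (D.totient : ℝ) * (μ - W / D) ^ 2 := by positivity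
    linarith
  have h2 : ∑ u : (ZMod D)ˣ, (z u - W / D) ^ 2 ≤ ∑ a : ZMod D, (z a - W / D) ^ 2 := by
    have : ∑ u : (ZMod D)ˣ, (z u - W / D) ^ 2 =
        ∑ a ∈ (Finset.univ : Finset (ZMod D)ˣ).map ⟨Units.val, Units.val_injective⟩,
          (z a - W / D) ^ 2 := by
      rw [sum_map]; rfl
    rw [this]
    exact sum_le_sum_of_subset_of_nonneg (subset_univ _) fun _ _ _ => by positivity
  have h3 : D * ∑ a : ZMod D, (z a - W / D) ^ 2 = D * ∑ a : ZMod D, z a ^ 2 - W ^ 2 := by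
    have e : ∀ a : ZMod D, (z a - W / D) ^ 2 = z a ^ 2 - 2 * (W / D) * z a + (W / D) ^ 2 :=
      fun a => by ring
    have hc : ((Finset.univ : Finset (ZMod D)).card : ℝ) = D := by
      rw [Finset.card_univ, ZMod.card]
    simp_rw [e, sum_add_distrib, sum_sub_distrib, ← mul_sum, sum_const, nsmul_eq_mul, hc, hz,
      sum_classSum, ← hW]
    field_simp
    ring
  have h4 := sum_sq_norm_expSum f N D
  rw [← add_sum_erase _ _ (mem_range.2 hD)] at h4
  have h5 : ‖∑ m ∈ range N, (f m : ℂ) * expChar (m * (((0 : ℕ) : ℝ) / D))‖ ^ 2 = W ^ 2 := by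
    simp only [Nat.cast_zero, zero_div, mul_zero, expChar_zero, mul_one]
    rw [← Complex.ofReal_sum, Complex.norm_real, Real.norm_eq_abs, sq_abs]
  rw [h5] at h4
  have h6 := mul_le_mul_of_nonneg_left (h1.trans h2) hD0.le
  rw [h3] at h6
  linarith

lemma mul_unitVariance_mul_le (f : ℕ → ℝ) (N : ℕ) {p q : ℕ} (hp : p.Prime) (hq : q.Prime)
    [NeZero (p * q)] :
    ((p * q : ℕ) : ℝ) * unitVariance f N (p * q) ≤
      reducedSum f N (p * q) + reducedSum f N p + reducedSum f N q := by
  refine (mul_unitVariance_le f N (p * q)).trans ?_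
  set F : ℝ → ℝ := fun t => ‖∑ m ∈ range N, (f m : ℂ) * expChar (m * t)‖ ^ 2 with hF
  have hF0 : ∀ t, 0 ≤ F t := fun t => by positivity
  have hmul : ∀ {p q : ℕ}, p.Prime → q.Prime →
      ∑ b ∈ ((range (p * q)).erase 0).filter (p ∣ ·), F ((b : ℝ) / (p * q : ℕ)) ≤
      reducedSum f N q := by
    intro p q hp hq
    have : ((range (p * q)).erase 0).filter (p ∣ ·) ⊆
        ((range q).filter (fun b => b.Coprime q)).image (p * ·) := by
      intro b hb
      simp only [mem_filter, mem_erase, mem_range, mem_image] at *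
      obtain ⟨⟨h0, h1⟩, k, rfl⟩ := hb
      have hk : k < q := lt_of_mul_lt_mul_left h1 (Nat.zero_le _)
      have hk0 : k ≠ 0 := by rintro rfl; simp at h0
      refine ⟨k, ⟨hk, ?_⟩, rfl⟩
      exact (Nat.coprime_of_lt_prime hk0 hk hq).symm
    refine (sum_le_sum_of_subset_of_nonneg this fun _ _ _ => hF0 _).trans (le_of_eq ?_)
    rw [sum_image (fun a _ b _ h => Nat.eq_of_mul_eq_mul_left hp.pos h), reducedSum]
    refine sum_congr rfl fun b _ => ?_
    have hp0 : (p : ℝ) ≠ 0 := by exact_mod_cast hp.ne_zero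
    simp only [hF]
    have : ((p * b : ℕ) : ℝ) / (p * q : ℕ) = b / q := by
      push_cast
      rw [mul_div_mul_left _ _ hp0]
    rw [this]
  have h1 := hmul hp hq
  have h2 := hmul hq hp
  rw [mul_comm q p] at h2
  have h3 : (range (p * q)).erase 0 ⊆ ((range (p * q)).filter (fun b => b.Coprime (p * q))) ∪
      (((range (p * q)).erase 0).filter (p ∣ ·) ∪ ((range (p * q)).erase 0).filter (q ∣ ·)) := by
    intro b hb
    simp only [mem_union, mem_filter]
    by_cases h : p ∣ b
    · exact Or.inr (Or.inl ⟨hb, h⟩)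
    by_cases h' : q ∣ b
    · exact Or.inr (Or.inr ⟨hb, h'⟩)
    refine Or.inl ⟨mem_of_mem_erase hb, ?_⟩
    exact Nat.Coprime.mul_right ((hp.coprime_iff_not_dvd.2 h).symm)
      ((hq.coprime_iff_not_dvd.2 h').symm)
  have hun : ∀ s t : Finset ℕ, ∑ b ∈ s ∪ t, F ((b : ℝ) / (p * q : ℕ)) ≤
      ∑ b ∈ s, F ((b : ℝ) / (p * q : ℕ)) + ∑ b ∈ t, F ((b : ℝ) / (p * q : ℕ)) := fun s t => by
    rw [← sum_union_inter]
    have : 0 ≤ ∑ b ∈ s ∩ t, F ((b : ℝ) / (p * q : ℕ)) := sum_nonneg fun _ _ => hF0 _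
    linarith
  have h4 := sum_le_sum_of_subset_of_nonneg (f := fun b : ℕ => F ((b : ℝ) / (p * q : ℕ))) h3
    fun _ _ _ => hF0 _
  have h5 := hun ((range (p * q)).filter (fun b => b.Coprime (p * q)))
    (((range (p * q)).erase 0).filter (p ∣ ·) ∪ ((range (p * q)).erase 0).filter (q ∣ ·))
  have h6 := hun (((range (p * q)).erase 0).filter (p ∣ ·))
    (((range (p * q)).erase 0).filter (q ∣ ·))
  have h7 : ∑ b ∈ (range (p * q)).filter (fun b => b.Coprime (p * q)),
      F ((b : ℝ) / (p * q : ℕ)) = reducedSum f N (p * q) := rfl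
  rw [h7] at h5
  linarith

/-- The balanced indicator function of a reduced residue class. -/
noncomputable def balancedInd (D : ℕ) (c : (ZMod D)ˣ) (n : ℕ) : ℝ :=
  (if (n : ZMod D) = c then 1 else 0) - (if n.Coprime D then 1 else 0) / D.totient

lemma bilinear_balancedInd_eq (f g : ℕ → ℝ) (M L D : ℕ) [NeZero D] (c : (ZMod D)ˣ) :
    ∑ m ∈ range M, ∑ l ∈ range L, f m * g l * balancedInd D c (m * l) =
      ∑ u : (ZMod D)ˣ, (classSum f M (u : ZMod D) - unitMean f M D) *
        (classSum g L ((u⁻¹ * c : (ZMod D)ˣ) : ZMod D) - unitMean g L D) := by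
  classical
  have hφ : (D.totient : ℝ) ≠ 0 := by exact_mod_cast (Nat.totient_pos.2 (NeZero.pos D)).ne'
  have hc : ((Finset.univ : Finset (ZMod D)ˣ).card : ℝ) = D.totient := by
    rw [Finset.card_univ, ZMod.card_units_eq_totient]
  have hs : ∀ (h : ℕ → ℝ) (N : ℕ), ∑ u : (ZMod D)ˣ, classSum h N (u : ZMod D) =
      D.totient * unitMean h N D := fun h N => by
    rw [unitMean]; field_simp
  have hs' : ∑ u : (ZMod D)ˣ, classSum g L ((u⁻¹ * c : (ZMod D)ˣ) : ZMod D) =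
      D.totient * unitMean g L D := by
    rw [← hs g L]
    exact Fintype.sum_equiv ((Equiv.inv _).trans (Equiv.mulRight c)) _ _ fun u => rfl
  have hu : ∀ (h : ℕ → ℝ) (N : ℕ), ∑ u : (ZMod D)ˣ, classSum h N (u : ZMod D) =
      ∑ m ∈ range N, if m.Coprime D then h m else 0 := by
    intro h N
    simp_rw [classSum]
    rw [sum_comm]
    refine sum_congr rfl fun m _ => ?_
    split_ifs with hm
    · obtain ⟨v, hv⟩ := (ZMod.isUnit_iff_coprime m D).2 hm
      rw [← hv]
      simp_rw [Units.val_inj]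
      simp
    · refine sum_eq_zero fun u _ => if_neg fun h =>
        hm ((ZMod.isUnit_iff_coprime m D).1 (by rw [h]; exact u.isUnit))
  have h1 : ∑ u : (ZMod D)ˣ, classSum f M (u : ZMod D) *
      classSum g L ((u⁻¹ * c : (ZMod D)ˣ) : ZMod D) =
      ∑ m ∈ range M, ∑ l ∈ range L, f m * g l * if ((m * l : ℕ) : ZMod D) = c then 1 else 0 := by
    simp_rw [classSum, sum_mul_sum]
    rw [sum_comm]
    refine sum_congr rfl fun m _ => ?_
    rw [sum_comm]
    refine sum_congr rfl fun l _ => ?_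
    by_cases hm : ∃ v : (ZMod D)ˣ, (v : ZMod D) = m
    · obtain ⟨v, hv⟩ := hm
      rw [sum_eq_single v]
      · rw [if_pos hv.symm, Nat.cast_mul, ← hv]
        have : ((l : ZMod D) = ((v⁻¹ * c : (ZMod D)ˣ) : ZMod D)) ↔ (v : ZMod D) * l = c := by
          rw [Units.val_mul, Units.eq_inv_mul_iff_mul_eq]
        simp only [this]
        split_ifs <;> simp
      · intro u _ huv
        rw [if_neg, zero_mul]
        rw [← hv]
        exact fun h => huv (Units.ext h).symm
      · simp
    · rw [sum_eq_zero, if_neg, mul_zero]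
      · intro h
        apply hm
        have : IsUnit ((m : ZMod D) * l) := by
          rw [← Nat.cast_mul, h]; exact c.isUnit
        exact isUnit_of_mul_isUnit_left this
      · intro u _
        rw [if_neg fun h => hm ⟨u, h.symm⟩, zero_mul]
  have h2 : ∑ m ∈ range M, ∑ l ∈ range L, f m * g l *
      ((if (m * l).Coprime D then 1 else 0) / D.totient) =
      D.totient * unitMean f M D * unitMean g L D := by
    have e1 : D.totient * unitMean f M D * unitMean g L D =
        (∑ u : (ZMod D)ˣ, classSum f M (u : ZMod D)) *
        (∑ u : (ZMod D)ˣ, classSum g L (u : ZMod D)) / D.totient := by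
      rw [hs, hs]; field_simp
    rw [e1, hu, hu, sum_mul_sum, sum_div]
    refine sum_congr rfl fun m _ => ?_
    rw [sum_div]
    refine sum_congr rfl fun l _ => ?_
    by_cases h : m.Coprime D
    · by_cases h' : l.Coprime D
      · rw [if_pos h, if_pos h', if_pos (Nat.coprime_mul_iff_left.2 ⟨h, h'⟩)]
        ring
      · rw [if_neg h', if_neg fun h3 => h' (Nat.coprime_mul_iff_left.1 h3).2]
        simp
    · rw [if_neg h, if_neg fun h3 => h (Nat.coprime_mul_iff_left.1 h3).1]
      simp
  simp_rw [balancedInd, mul_sub, sum_sub_distrib]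
  rw [h2, ← h1]
  simp_rw [sub_mul, sum_sub_distrib, ← mul_sum, ← sum_mul]
  rw [hs, hs']
  simp only [sum_const, nsmul_eq_mul, hc]
  ring

lemma abs_bilinear_balancedInd_le (f g : ℕ → ℝ) (M L D : ℕ) [NeZero D] (c : (ZMod D)ˣ) :
    |∑ m ∈ range M, ∑ l ∈ range L, f m * g l * balancedInd D c (m * l)| ≤
      √(unitVariance f M D) * √(unitVariance g L D) := by
  rw [bilinear_balancedInd_eq]
  have h := Real.sum_mul_le_sqrt_mul_sqrt (Finset.univ : Finset (ZMod D)ˣ)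
    (fun u => |classSum f M (u : ZMod D) - unitMean f M D|)
    (fun u => |classSum g L ((u⁻¹ * c : (ZMod D)ˣ) : ZMod D) - unitMean g L D|)
  simp only [sq_abs] at h
  have e : ∑ u : (ZMod D)ˣ, (classSum g L ((u⁻¹ * c : (ZMod D)ˣ) : ZMod D) - unitMean g L D) ^ 2 =
      unitVariance g L D :=
    Fintype.sum_equiv ((Equiv.inv _).trans (Equiv.mulRight c)) _ _ fun u => rfl
  rw [e] at h
  refine (abs_sum_le_sum_abs _ _).trans ?_
  simp_rw [abs_mul]
  exact h

/-- Data for a family of moduli `pq`, with `p < q` primes at most `z`. -/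
structure PrimePairs (𝒬 : Finset (ℕ × ℕ)) (z : ℕ) : Prop where
  prime_fst : ∀ P ∈ 𝒬, P.1.Prime
  prime_snd : ∀ P ∈ 𝒬, P.2.Prime
  lt : ∀ P ∈ 𝒬, P.1 < P.2
  le : ∀ P ∈ 𝒬, P.2 ≤ z

lemma PrimePairs.injOn {𝒬 : Finset (ℕ × ℕ)} {z : ℕ} (h : PrimePairs 𝒬 z) :
    Set.InjOn (fun P : ℕ × ℕ => P.1 * P.2) (𝒬 : Set (ℕ × ℕ)) := by
  rintro ⟨p, q⟩ hP ⟨p', q'⟩ hP' hEq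
  have h1 := h.prime_fst _ hP
  have h2 := h.prime_snd _ hP
  have h3 := h.lt _ hP
  have h1' := h.prime_fst _ hP'
  have h2' := h.prime_snd _ hP'
  have h3' := h.lt _ hP'
  simp only at *
  have hd : p ∣ p' * q' := ⟨q, hEq.symm⟩
  rcases (h1.dvd_mul).1 hd with hd | hd
  · have := (Nat.prime_dvd_prime_iff_eq h1 h1').1 hd
    subst this
    rw [Nat.eq_of_mul_eq_mul_left h1.pos hEq]
  · have := (Nat.prime_dvd_prime_iff_eq h1 h2').1 hd
    subst this
    rw [mul_comm p' p] at hEq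
    have := Nat.eq_of_mul_eq_mul_left h1.pos hEq
    omega

/-- The factor in the large sieve bound over moduli that are products of two primes. -/
noncomputable def sieveFactor (z N : ℕ) : ℝ := 24 * (z * N + (z : ℝ) ^ 4)

lemma sieveFactor_nonneg (z N : ℕ) : 0 ≤ sieveFactor z N := by
  rw [sieveFactor]; positivity

lemma sum_mul_unitVariance_le {𝒬 : Finset (ℕ × ℕ)} {z : ℕ} (h : PrimePairs 𝒬 z) (hz : 1 ≤ z)
    (f : ℕ → ℝ) (N : ℕ) :
    ∑ P ∈ 𝒬.attach, ((P.1.1 * P.1.2 : ℕ) : ℝ) *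
      (haveI : NeZero (P.1.1 * P.1.2) :=
        ⟨mul_ne_zero (h.prime_fst _ P.2).ne_zero (h.prime_snd _ P.2).ne_zero⟩
      unitVariance f N (P.1.1 * P.1.2)) ≤ sieveFactor z N * ∑ m ∈ range N, f m ^ 2 := by
  have hz0 : (1 : ℝ) ≤ z := by exact_mod_cast hz
  set A := ∑ m ∈ range N, f m ^ 2 with hA
  have hA0 : 0 ≤ A := sum_nonneg fun _ _ => by positivity
  have h1 : ∑ P ∈ 𝒬, reducedSum f N (P.1 * P.2) ≤ 8 * (N + (z : ℝ) ^ 4) * A := by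
    have := sum_reducedSum_le f N (Z := z ^ 2) (Nat.one_le_pow _ _ hz)
    rw [← sum_image (f := fun d => reducedSum f N d) h.injOn]
    refine le_trans (sum_le_sum_of_subset_of_nonneg ?_ fun _ _ _ => reducedSum_nonneg _ _ _)
      (this.trans (le_of_eq ?_))
    · intro d hd
      obtain ⟨P, hP, rfl⟩ := mem_image.1 hd
      have h1 := (h.prime_fst _ hP).pos
      have h2 := (h.prime_snd _ hP).pos
      have h3 := h.lt _ hP
      have h4 := h.le _ hP
      exact mem_Icc.2 ⟨Nat.mul_pos h1 h2, by nlinarith⟩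
    · push_cast; ring
  have hsub : 𝒬 ⊆ Icc 1 z ×ˢ Icc 1 z := by
    intro P hP
    have h1 := (h.prime_fst _ hP).pos
    have h2 := (h.prime_snd _ hP).pos
    have h3 := h.lt _ hP
    have h4 := h.le _ hP
    simp only [mem_product, mem_Icc]
    omega
  have h23 := sum_reducedSum_le f N hz
  have h2 : ∑ P ∈ 𝒬, reducedSum f N P.1 ≤ z * (8 * (N + (z : ℝ) ^ 2) * A) := by
    refine (sum_le_sum_of_subset_of_nonneg hsub fun _ _ _ => reducedSum_nonneg _ _ _).trans ?_
    rw [sum_product]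
    simp only [sum_const, Nat.card_Icc, add_tsub_cancel_right, nsmul_eq_mul]
    rw [← mul_sum]
    gcongr
  have h3 : ∑ P ∈ 𝒬, reducedSum f N P.2 ≤ z * (8 * (N + (z : ℝ) ^ 2) * A) := by
    refine (sum_le_sum_of_subset_of_nonneg hsub fun _ _ _ => reducedSum_nonneg _ _ _).trans ?_
    rw [sum_product]
    simp only [sum_const, Nat.card_Icc, add_tsub_cancel_right, nsmul_eq_mul]
    gcongr
  have h4 : ∑ P ∈ 𝒬.attach, (reducedSum f N (P.1.1 * P.1.2) + reducedSum f N P.1.1 +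
      reducedSum f N P.1.2) ≤ sieveFactor z N * A := by
    rw [sum_attach 𝒬 (fun P => reducedSum f N (P.1 * P.2) + reducedSum f N P.1 +
      reducedSum f N P.2), sum_add_distrib, sum_add_distrib]
    refine (add_le_add (add_le_add h1 h2) h3).trans ?_
    have e : 8 * (N + (z : ℝ) ^ 4) + z * (8 * (N + (z : ℝ) ^ 2)) + z * (8 * (N + (z : ℝ) ^ 2)) ≤
        sieveFactor z N := by
      rw [sieveFactor]
      have hN : (0 : ℝ) ≤ N := Nat.cast_nonneg N
      have : (z : ℝ) ^ 3 ≤ (z : ℝ) ^ 4 := pow_le_pow_right₀ hz0 (by norm_num)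
      nlinarith
    calc _ = (8 * (N + (z : ℝ) ^ 4) + z * (8 * (N + (z : ℝ) ^ 2)) +
          z * (8 * (N + (z : ℝ) ^ 2))) * A := by ring
      _ ≤ _ := mul_le_mul_of_nonneg_right e hA0
  refine le_trans (sum_le_sum fun P _ => ?_) h4
  have : NeZero (P.1.1 * P.1.2) :=
    ⟨mul_ne_zero (h.prime_fst _ P.2).ne_zero (h.prime_snd _ P.2).ne_zero⟩
  exact mul_unitVariance_mul_le f N (h.prime_fst _ P.2) (h.prime_snd _ P.2)

/-- Mean-square distribution of a bilinear form in residue classes to moduli `pq`. -/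
lemma sum_mul_abs_bilinear_le {𝒬 : Finset (ℕ × ℕ)} {z : ℕ} (h : PrimePairs 𝒬 z) (hz : 1 ≤ z)
    (c : ∀ P : ℕ × ℕ, (ZMod (P.1 * P.2))ˣ) (f g : ℕ → ℝ) (M L : ℕ) :
    ∑ P ∈ 𝒬, ((P.1 * P.2 : ℕ) : ℝ) *
      |∑ m ∈ range M, ∑ l ∈ range L, f m * g l * balancedInd (P.1 * P.2) (c P) (m * l)| ≤
      √(sieveFactor z M * sieveFactor z L) *
        (√(∑ m ∈ range M, f m ^ 2) * √(∑ l ∈ range L, g l ^ 2)) := by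
  rw [← sum_attach 𝒬 (fun P => ((P.1 * P.2 : ℕ) : ℝ) *
    |∑ m ∈ range M, ∑ l ∈ range L, f m * g l * balancedInd (P.1 * P.2) (c P) (m * l)|)]
  have hne : ∀ P : {P // P ∈ 𝒬}, NeZero (P.1.1 * P.1.2) := fun P =>
    ⟨mul_ne_zero (h.prime_fst _ P.2).ne_zero (h.prime_snd _ P.2).ne_zero⟩
  set X : (ℕ → ℝ) → ℕ → {P // P ∈ 𝒬} → ℝ := fun f N P =>
    ((P.1.1 * P.1.2 : ℕ) : ℝ) * unitVariance f N (P.1.1 * P.1.2) with hX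
  have hX0 : ∀ f N P, 0 ≤ X f N P := fun f N P =>
    mul_nonneg (Nat.cast_nonneg _) (unitVariance_nonneg _ _ _)
  have h1 : ∀ P ∈ 𝒬.attach, ((P.1.1 * P.1.2 : ℕ) : ℝ) *
      |∑ m ∈ range M, ∑ l ∈ range L, f m * g l * balancedInd (P.1.1 * P.1.2) (c P.1) (m * l)| ≤
      √(X f M P) * √(X g L P) := by
    intro P _
    have h2 := abs_bilinear_balancedInd_le f g M L (P.1.1 * P.1.2) (c P.1)
    have h0 : (0 : ℝ) ≤ ((P.1.1 * P.1.2 : ℕ) : ℝ) := Nat.cast_nonneg _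
    refine (mul_le_mul_of_nonneg_left h2 h0).trans (le_of_eq ?_)
    simp only [hX]
    rw [Real.sqrt_mul h0, Real.sqrt_mul h0, mul_mul_mul_comm, Real.mul_self_sqrt h0]
  have h2 : ∀ f N, ∑ P ∈ 𝒬.attach, X f N P ≤ sieveFactor z N * ∑ m ∈ range N, f m ^ 2 :=
    fun f N => sum_mul_unitVariance_le h hz f N
  calc _ ≤ ∑ P ∈ 𝒬.attach, √(X f M P) * √(X g L P) := sum_le_sum h1
    _ ≤ √(∑ P ∈ 𝒬.attach, X f M P) * √(∑ P ∈ 𝒬.attach, X g L P) :=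
        Real.sum_sqrt_mul_sqrt_le _ (fun P => hX0 _ _ P) (fun P => hX0 _ _ P)
    _ ≤ √(sieveFactor z M * ∑ m ∈ range M, f m ^ 2) * √(sieveFactor z L * ∑ l ∈ range L, g l ^ 2) :=
        mul_le_mul (Real.sqrt_le_sqrt (h2 f M)) (Real.sqrt_le_sqrt (h2 g L))
          (Real.sqrt_nonneg _) (Real.sqrt_nonneg _)
    _ = _ := by
        rw [Real.sqrt_mul (sieveFactor_nonneg _ _), Real.sqrt_mul (sieveFactor_nonneg _ _),
          Real.sqrt_mul (sieveFactor_nonneg _ _)]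
        ring

lemma ind_lt_eq_sum_add (J l y : ℕ) :
    (if l < y then 1 else 0 : ℝ) =
      (∑ j ∈ range J, if (y / 2 ^ j) % 2 = 1 ∧ l / 2 ^ j + 1 = y / 2 ^ j then 1 else 0) +
        if l / 2 ^ J < y / 2 ^ J then 1 else 0 := by
  induction J with
  | zero => simp
  | succ J ih =>
    rw [ih, sum_range_succ, add_assoc]
    congr 1
    rw [pow_succ, ← Nat.div_div_eq_div_mul, ← Nat.div_div_eq_div_mul]
    generalize l / 2 ^ J = a
    generalize y / 2 ^ J = b
    by_cases h1 : b % 2 = 1 ∧ a + 1 = b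
    · rw [if_pos h1, if_pos (by omega), if_neg (by omega), add_zero]
    · rw [if_neg h1, zero_add]
      by_cases h2 : a < b
      · rw [if_pos h2, if_pos (by omega)]
      · rw [if_neg h2, if_neg (by omega)]

/-- The binary decomposition of an initial segment into dyadic intervals. -/
lemma ind_lt_eq_sum {J y : ℕ} (hy : y < 2 ^ J) (l : ℕ) :
    (if l < y then 1 else 0 : ℝ) =
      ∑ j ∈ range J, if (y / 2 ^ j) % 2 = 1 ∧ l / 2 ^ j + 1 = y / 2 ^ j then 1 else 0 := by
  rw [ind_lt_eq_sum_add J l y, Nat.div_eq_of_lt hy]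
  simp

lemma sum_sum_ite_sq_le (N T : ℕ) (t : ℕ → ℕ) (Q : ℕ → Prop) [DecidablePred Q] (f : ℕ → ℝ) :
    ∑ s ∈ range T, ∑ m ∈ range N, (if t m = s ∧ Q s then f m else 0) ^ 2 ≤
      ∑ m ∈ range N, f m ^ 2 := by
  rw [sum_comm]
  refine sum_le_sum fun m _ => ?_
  calc ∑ s ∈ range T, (if t m = s ∧ Q s then f m else 0) ^ 2
      ≤ ∑ s ∈ range T, if t m = s then f m ^ 2 else 0 := by
        refine sum_le_sum fun s _ => ?_
        by_cases h : t m = s <;> by_cases h' : Q s <;> simp [h, h']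
        positivity
    _ ≤ f m ^ 2 := by
        rw [sum_ite_eq]
        split_ifs
        · exact le_rfl
        · positivity

/-- `sum_mul_abs_bilinear_le` with a hyperbolic-type cutoff `l < y m`. -/
lemma sum_mul_abs_bilinear_cutoff_le {𝒬 : Finset (ℕ × ℕ)} {z : ℕ} (h : PrimePairs 𝒬 z)
    (hz : 1 ≤ z) (c : ∀ P : ℕ × ℕ, (ZMod (P.1 * P.2))ˣ) (f g : ℕ → ℝ) (M L J : ℕ) (y : ℕ → ℕ)
    (hy : ∀ m, y m < 2 ^ J) :
    ∑ P ∈ 𝒬, ((P.1 * P.2 : ℕ) : ℝ) *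
      |∑ m ∈ range M, ∑ l ∈ range L,
        if l < y m then f m * g l * balancedInd (P.1 * P.2) (c P) (m * l) else 0| ≤
      J * (√(sieveFactor z M * sieveFactor z L) *
        (√(∑ m ∈ range M, f m ^ 2) * √(∑ l ∈ range L, g l ^ 2))) := by
  set F : ℕ → ℕ → ℕ → ℝ := fun j t m => if y m / 2 ^ j = t ∧ t % 2 = 1 then f m else 0 with hF
  set G : ℕ → ℕ → ℕ → ℝ := fun j t l => if l / 2 ^ j + 1 = t ∧ True then g l else 0 with hG
  have hdec : ∀ K : ℕ → ℝ, ∑ m ∈ range M, ∑ l ∈ range L,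
      (if l < y m then f m * g l * K (m * l) else 0) =
      ∑ j ∈ range J, ∑ t ∈ range (2 ^ J), ∑ m ∈ range M, ∑ l ∈ range L,
        F j t m * G j t l * K (m * l) := by
    intro K
    have e1 : ∀ m l, (if l < y m then f m * g l * K (m * l) else 0) =
        ∑ j ∈ range J, ∑ t ∈ range (2 ^ J), F j t m * G j t l * K (m * l) := by
      intro m l
      have e2 : (if l < y m then f m * g l * K (m * l) else 0) =
          (if l < y m then 1 else 0) * (f m * g l * K (m * l)) := by split_ifs <;> simp
      rw [e2, ind_lt_eq_sum (hy m), sum_mul]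
      refine sum_congr rfl fun j _ => ?_
      rw [sum_eq_single (y m / 2 ^ j)]
      · by_cases h1 : (y m / 2 ^ j) % 2 = 1 <;> by_cases h2 : l / 2 ^ j + 1 = y m / 2 ^ j <;>
          simp [hF, hG, h1, h2]
      · intro t _ ht
        simp [hF, Ne.symm ht]
      · intro hn
        exact absurd (mem_range.2 ((Nat.div_le_self _ _).trans_lt (hy m))) hn
    simp_rw [e1]
    rw [sum_congr rfl fun m _ => sum_comm, sum_comm]
    refine sum_congr rfl fun j _ => ?_
    rw [sum_congr rfl fun m _ => sum_comm, sum_comm]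
  set S := √(sieveFactor z M * sieveFactor z L) with hS
  have hS0 : 0 ≤ S := Real.sqrt_nonneg _
  calc _ ≤ ∑ P ∈ 𝒬, ∑ j ∈ range J, ∑ t ∈ range (2 ^ J), ((P.1 * P.2 : ℕ) : ℝ) *
        |∑ m ∈ range M, ∑ l ∈ range L,
          F j t m * G j t l * balancedInd (P.1 * P.2) (c P) (m * l)| := by
        refine sum_le_sum fun P _ => ?_
        rw [hdec]
        simp_rw [← mul_sum]
        refine mul_le_mul_of_nonneg_left ?_ (Nat.cast_nonneg _)
        exact (abs_sum_le_sum_abs _ _).trans (sum_le_sum fun j _ => abs_sum_le_sum_abs _ _)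
    _ = ∑ j ∈ range J, ∑ t ∈ range (2 ^ J), ∑ P ∈ 𝒬, ((P.1 * P.2 : ℕ) : ℝ) *
        |∑ m ∈ range M, ∑ l ∈ range L,
          F j t m * G j t l * balancedInd (P.1 * P.2) (c P) (m * l)| := by
        rw [sum_comm]
        exact sum_congr rfl fun j _ => sum_comm
    _ ≤ ∑ j ∈ range J, ∑ t ∈ range (2 ^ J),
        S * (√(∑ m ∈ range M, F j t m ^ 2) * √(∑ l ∈ range L, G j t l ^ 2)) :=
        sum_le_sum fun j _ => sum_le_sum fun t _ => sum_mul_abs_bilinear_le h hz c _ _ M L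
    _ ≤ ∑ j ∈ range J, S * (√(∑ m ∈ range M, f m ^ 2) * √(∑ l ∈ range L, g l ^ 2)) := by
        refine sum_le_sum fun j _ => ?_
        rw [← mul_sum]
        refine mul_le_mul_of_nonneg_left ?_ hS0
        refine (Real.sum_sqrt_mul_sqrt_le _ (fun t => sum_nonneg fun _ _ => sq_nonneg _)
          (fun t => sum_nonneg fun _ _ => sq_nonneg _)).trans ?_
        exact mul_le_mul (Real.sqrt_le_sqrt (sum_sum_ite_sq_le M (2 ^ J) _ _ f))
          (Real.sqrt_le_sqrt (sum_sum_ite_sq_le L (2 ^ J) _ (fun _ => True) g))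
          (Real.sqrt_nonneg _) (Real.sqrt_nonneg _)
    _ = _ := by rw [sum_const, card_range, nsmul_eq_mul]

lemma sum_sq_range_le {f : ℕ → ℝ} {N : ℕ} {B : ℝ} (h : ∀ m < N, |f m| ≤ B) :
    ∑ m ∈ range N, f m ^ 2 ≤ N * B ^ 2 := by
  calc _ ≤ ∑ m ∈ range N, B ^ 2 := by
        refine sum_le_sum fun m hm => ?_
        rw [← sq_abs]
        exact pow_le_pow_left₀ (abs_nonneg _) (h m (mem_range.1 hm)) 2
    _ = _ := by simp

lemma dyadic_sieve_bound {z M L U x : ℕ} {G : ℝ} (hG : 0 ≤ G) (hU : 0 < U) (hM : M * U ≤ 2 * x)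
    (hL : L * U ≤ 4 * x) (hML : M * L ≤ 4 * x) :
    √(sieveFactor z M * sieveFactor z L) * (√(M * 1 ^ 2) * √(L * G ^ 2)) ≤
      48 * G * √(x * (4 * z ^ 2 * x + 6 * z ^ 5 * x / U + z ^ 8)) := by
  have hU0 : (0 : ℝ) < U := by exact_mod_cast hU
  have hM' : (M : ℝ) ≤ 2 * x / U := by rw [le_div_iff₀ hU0]; exact_mod_cast hM
  have hL' : (L : ℝ) ≤ 4 * x / U := by rw [le_div_iff₀ hU0]; exact_mod_cast hL
  have hML' : (M : ℝ) * L ≤ 4 * x := by exact_mod_cast hML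
  have hz0 : (0 : ℝ) ≤ z := Nat.cast_nonneg z
  have hx0 : (0 : ℝ) ≤ x := Nat.cast_nonneg x
  have hB := sieveFactor_nonneg z M
  have hB' := sieveFactor_nonneg z L
  rw [← Real.sqrt_mul (by positivity), ← Real.sqrt_mul (mul_nonneg hB hB')]
  refine Real.sqrt_le_iff.2 ⟨by positivity, ?_⟩
  rw [mul_pow, Real.sq_sqrt (by positivity)]
  have h1 : sieveFactor z M * sieveFactor z L ≤
      576 * (4 * z ^ 2 * x + 6 * z ^ 5 * x / U + z ^ 8) := by
    have e : sieveFactor z M * sieveFactor z L =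
        576 * ((z : ℝ) ^ 2 * (M * L) + (z : ℝ) ^ 5 * (M + L) + (z : ℝ) ^ 8) := by
      rw [sieveFactor, sieveFactor]; ring
    have e2 : (z : ℝ) ^ 5 * (M + L) ≤ (z : ℝ) ^ 5 * (6 * x / U) := by
      have : 2 * (x : ℝ) / U + 4 * x / U = 6 * x / U := by ring
      gcongr
      linarith
    have e3 : (z : ℝ) ^ 2 * (M * L) ≤ (z : ℝ) ^ 2 * (4 * x) := by gcongr
    have e4 : 6 * (z : ℝ) ^ 5 * x / U = (z : ℝ) ^ 5 * (6 * x / U) := by ring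
    rw [e, e4]
    linarith
  have h2 : (M : ℝ) * 1 ^ 2 * (L * G ^ 2) ≤ 4 * x * G ^ 2 := by
    have := mul_le_mul_of_nonneg_right hML' (sq_nonneg G)
    linarith
  calc _ ≤ (576 * (4 * z ^ 2 * x + 6 * z ^ 5 * x / U + z ^ 8)) * (4 * x * G ^ 2) :=
        mul_le_mul h1 h2 (by positivity) (by positivity)
    _ = _ := by ring

/-- The type II estimate. -/
lemma typeII_bound {𝒬 : Finset (ℕ × ℕ)} {z : ℕ} (h : PrimePairs 𝒬 z)
    (hz : 1 ≤ z) (c : ∀ P : ℕ × ℕ, (ZMod (P.1 * P.2))ˣ) (f g : ℕ → ℝ) {x U J : ℕ} {G : ℝ}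
    (hU : 1 ≤ U) (hJ : x + 1 < 2 ^ J) (hf : ∀ m, |f m| ≤ 1) (hg : ∀ l ≤ x, |g l| ≤ G)
    (hfU : ∀ m ≤ U, f m = 0) (hgU : ∀ l ≤ U, g l = 0) :
    ∑ P ∈ 𝒬, ((P.1 * P.2 : ℕ) : ℝ) *
      |∑ m ∈ range (x + 1), ∑ l ∈ range (x + 1),
        if m * l ≤ x then f m * g l * balancedInd (P.1 * P.2) (c P) (m * l) else 0| ≤
      (J : ℝ) ^ 2 * (48 * G * √(x * (4 * z ^ 2 * x + 6 * z ^ 5 * x / U + z ^ 8))) := by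
  have hG : 0 ≤ G := (abs_nonneg _).trans (hg 0 (Nat.zero_le _))
  set R : ℝ := 48 * G * √(x * (4 * z ^ 2 * x + 6 * z ^ 5 * x / U + z ^ 8)) with hR
  have hR0 : 0 ≤ R := by positivity
  set F : ℕ → ℕ → ℝ := fun i m => if Nat.log 2 m = i then f m else 0 with hF
  have hF1 : ∀ i m, |F i m| ≤ 1 := fun i m => by
    simp only [hF]
    split_ifs
    · exact hf m
    · simp
  have hf0 : f 0 = 0 := hfU 0 (Nat.zero_le _)
  have hg0 : g 0 = 0 := hgU 0 (Nat.zero_le _)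
  -- the contribution of each dyadic range of `m`
  have hdy : ∀ K : ℕ → ℝ, ∑ m ∈ range (x + 1), ∑ l ∈ range (x + 1),
      (if m * l ≤ x then f m * g l * K (m * l) else 0) =
      ∑ i ∈ range J, ∑ m ∈ range (2 ^ (i + 1)), ∑ l ∈ range (x / 2 ^ i + 1),
        if l < x / m + 1 then F i m * g l * K (m * l) else 0 := by
    intro K
    have e1 : ∀ m ∈ range (x + 1), ∑ l ∈ range (x + 1),
        (if m * l ≤ x then f m * g l * K (m * l) else 0) =
        ∑ i ∈ range J, ∑ l ∈ range (x / 2 ^ i + 1),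
          if l < x / m + 1 then F i m * g l * K (m * l) else 0 := by
      intro m hm
      rw [mem_range] at hm
      rcases Nat.eq_zero_or_pos m with rfl | hm0
      · simp [hF, hf0]
      have hlog : Nat.log 2 m ∈ range J := by
        rw [mem_range]
        exact Nat.log_lt_of_lt_pow hm0.ne' (by omega)
      rw [sum_eq_single_of_mem _ hlog (fun i _ hi => by simp [hF, Ne.symm hi])]
      have hle : x / m ≤ x / 2 ^ Nat.log 2 m :=
        Nat.div_le_div_left (Nat.pow_log_le_self 2 hm0.ne') (by positivity)
      have hsub : range (x / 2 ^ Nat.log 2 m + 1) ⊆ range (x + 1) :=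
        range_subset_range.2 (Nat.succ_le_succ (Nat.div_le_self _ _))
      have hiff : ∀ l, m * l ≤ x ↔ l < x / m + 1 := fun l => by
        rw [Nat.lt_succ_iff, Nat.le_div_iff_mul_le hm0, mul_comm]
      rw [← sum_subset hsub]
      · refine sum_congr rfl fun l _ => ?_
        simp only [hF, hiff, if_true]
      · intro l _ hl
        rw [mem_range] at hl
        rw [if_neg]
        rw [hiff]
        omega
    rw [sum_congr rfl e1, sum_comm]
    refine sum_congr rfl fun i _ => ?_
    -- both sums run over `2 ^ i ≤ m < 2 ^ (i + 1)` with `m ≤ x`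
    have hz1 : ∀ m, m ∉ range (2 ^ (i + 1)) → F i m = 0 := by
      intro m hm
      simp only [hF]
      refine if_neg fun hl => hm ?_
      rw [mem_range, ← hl]
      exact Nat.lt_pow_succ_log_self one_lt_two m
    have hz2 : ∀ m, m ∉ range (x + 1) → ∀ l,
        (if l < x / m + 1 then F i m * g l * K (m * l) else 0) = 0 := by
      intro m hm l
      rw [mem_range] at hm
      rw [Nat.div_eq_of_lt (by omega)]
      split_ifs with hl
      · have : l = 0 := by omega
        rw [this, hg0]; simp
      · rfl
    rw [← sum_inter_add_sum_sdiff (range (x + 1)) (range (2 ^ (i + 1))),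
      ← sum_inter_add_sum_sdiff (range (2 ^ (i + 1))) (range (x + 1)), inter_comm]
    congr 1
    rw [sum_eq_zero, sum_eq_zero]
    · intro m hm
      exact sum_eq_zero fun l _ => hz2 m (mem_sdiff.1 hm).2 l
    · intro m hm
      exact sum_eq_zero fun l _ => by rw [hz1 m (mem_sdiff.1 hm).2]; simp
  have hmain : ∀ i ∈ range J, ∑ P ∈ 𝒬, ((P.1 * P.2 : ℕ) : ℝ) *
      |∑ m ∈ range (2 ^ (i + 1)), ∑ l ∈ range (x / 2 ^ i + 1),
        if l < x / m + 1 then F i m * g l * balancedInd (P.1 * P.2) (c P) (m * l) else 0| ≤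
      J * R := by
    intro i _
    have hzero : ((∀ m < 2 ^ (i + 1), F i m = 0) ∨ (∀ l < x / 2 ^ i + 1, g l = 0)) →
        ∑ P ∈ 𝒬, ((P.1 * P.2 : ℕ) : ℝ) *
        |∑ m ∈ range (2 ^ (i + 1)), ∑ l ∈ range (x / 2 ^ i + 1),
          if l < x / m + 1 then F i m * g l * balancedInd (P.1 * P.2) (c P) (m * l) else 0| ≤
        J * R := by
      intro h0
      rw [sum_eq_zero]
      · positivity
      intro P _
      rw [sum_eq_zero, abs_zero, mul_zero]
      intro m hm
      refine sum_eq_zero fun l hl => ?_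
      rcases h0 with h0 | h0
      · rw [h0 m (mem_range.1 hm)]; simp
      · rw [h0 l (mem_range.1 hl)]; simp
    by_cases h1 : 2 ^ (i + 1) ≤ U
    · refine hzero (Or.inl fun m hm => ?_)
      simp only [hF]
      rw [hfU m (by omega)]
      simp
    by_cases h2 : x / 2 ^ i ≤ U
    · exact hzero (Or.inr fun l hl => hgU l (by omega))
    push Not at h1 h2
    refine (sum_mul_abs_bilinear_cutoff_le h hz c (F i) g _ _ J (fun m => x / m + 1)
      (fun m => ?_)).trans ?_
    · have := Nat.div_le_self x m
      omega
    refine mul_le_mul_of_nonneg_left ?_ (Nat.cast_nonneg _)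
    have hp : 0 < 2 ^ i := by positivity
    have hdm : 2 ^ i * (x / 2 ^ i) ≤ x := Nat.mul_div_le x _
    have hi2 : 2 ^ (i + 1) = 2 * 2 ^ i := by ring
    refine le_trans ?_ (dyadic_sieve_bound (z := z) (M := 2 ^ (i + 1)) (L := x / 2 ^ i + 1)
      (x := x) hG (by omega : 0 < U) ?_ ?_ ?_)
    · refine mul_le_mul_of_nonneg_left ?_ (Real.sqrt_nonneg _)
      refine mul_le_mul (Real.sqrt_le_sqrt (sum_sq_range_le fun m _ => hF1 i m))
        (Real.sqrt_le_sqrt (sum_sq_range_le fun l hl => hg l ?_))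
        (Real.sqrt_nonneg _) (Real.sqrt_nonneg _)
      have := Nat.div_le_self x (2 ^ i)
      omega
    · rw [hi2]; nlinarith
    · rw [hi2] at h1; nlinarith
    · rw [hi2]; nlinarith
  calc _ ≤ ∑ P ∈ 𝒬, ∑ i ∈ range J, ((P.1 * P.2 : ℕ) : ℝ) *
      |∑ m ∈ range (2 ^ (i + 1)), ∑ l ∈ range (x / 2 ^ i + 1),
        if l < x / m + 1 then F i m * g l * balancedInd (P.1 * P.2) (c P) (m * l) else 0| := by
        refine sum_le_sum fun P _ => ?_
        rw [hdy, ← mul_sum]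
        exact mul_le_mul_of_nonneg_left (abs_sum_le_sum_abs _ _) (Nat.cast_nonneg _)
    _ ≤ ∑ i ∈ range J, J * R := by
        rw [sum_comm]
        exact sum_le_sum hmain
    _ = _ := by rw [sum_const, card_range, nsmul_eq_mul]; ring

lemma abs_sum_ind_class_sub_le (D : ℕ) [NeZero D] (u : ZMod D) {a b : ℕ} (hab : a ≤ b) :
    |∑ l ∈ Ioc a b, (if (l : ZMod D) = u then (1 : ℝ) else 0) - ((b : ℝ) - a) / D| ≤ 1 := by
  have hD : 0 < D := NeZero.pos D
  have hD' : (0 : ℝ) < D := by exact_mod_cast hD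
  rw [← sum_filter, sum_const, nsmul_eq_mul, mul_one]
  have h1 : (Ioc a b).filter (fun l : ℕ => (l : ZMod D) = u) =
      (Ioc a b).filter (fun l => l ≡ u.val [MOD D]) := by
    refine filter_congr fun l _ => ?_
    rw [← ZMod.natCast_eq_natCast_iff, ZMod.natCast_zmod_val]
  have h2 := Nat.Ioc_filter_modEq_card a b hD u.val
  rw [← h1] at h2
  have h3 : (((Ioc a b).filter (fun l : ℕ => (l : ZMod D) = u)).card : ℝ) =
      ⌊((b : ℚ) - u.val) / D⌋ - ⌊((a : ℚ) - u.val) / D⌋ := by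
    rw [max_eq_left] at h2
    · exact_mod_cast h2
    · have : (a : ℚ) ≤ b := by exact_mod_cast hab
      rw [sub_nonneg]
      gcongr
  rw [h3]
  have q1 := Int.floor_le (((b : ℚ) - u.val) / D)
  have q2 := Int.lt_floor_add_one (((b : ℚ) - u.val) / D)
  have q3 := Int.floor_le (((a : ℚ) - u.val) / D)
  have q4 := Int.lt_floor_add_one (((a : ℚ) - u.val) / D)
  have r1 : ((⌊((b : ℚ) - u.val) / D⌋ : ℤ) : ℝ) ≤ ((b : ℝ) - u.val) / D := by exact_mod_cast q1
  have r2 : ((b : ℝ) - u.val) / D < ((⌊((b : ℚ) - u.val) / D⌋ : ℤ) : ℝ) + 1 := by exact_mod_cast q2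
  have r3 : ((⌊((a : ℚ) - u.val) / D⌋ : ℤ) : ℝ) ≤ ((a : ℝ) - u.val) / D := by exact_mod_cast q3
  have r4 : ((a : ℝ) - u.val) / D < ((⌊((a : ℚ) - u.val) / D⌋ : ℤ) : ℝ) + 1 := by exact_mod_cast q4
  have e : ((b : ℝ) - a) / D = ((b : ℝ) - u.val) / D - ((a : ℝ) - u.val) / D := by ring
  rw [e, abs_le]
  constructor <;> linarith

lemma balancedInd_eq_sub_mean (D : ℕ) [NeZero D] (c : (ZMod D)ˣ) (n : ℕ) :
    balancedInd D c n = (∑ u : (ZMod D)ˣ, ((if (n : ZMod D) = c then (1 : ℝ) else 0) -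
      if (n : ZMod D) = u then 1 else 0)) / D.totient := by
  have hφ : (D.totient : ℝ) ≠ 0 := by exact_mod_cast (Nat.totient_pos.2 (NeZero.pos D)).ne'
  have hc : ((Finset.univ : Finset (ZMod D)ˣ).card : ℝ) = D.totient := by
    rw [Finset.card_univ, ZMod.card_units_eq_totient]
  have h : (if n.Coprime D then (1 : ℝ) else 0) =
      ∑ u : (ZMod D)ˣ, if (n : ZMod D) = u then 1 else 0 := by
    split_ifs with hm
    · obtain ⟨v, hv⟩ := (ZMod.isUnit_iff_coprime n D).2 hm
      rw [← hv]
      simp_rw [Units.val_inj]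
      simp
    · exact (sum_eq_zero fun u _ => if_neg fun h =>
        hm ((ZMod.isUnit_iff_coprime n D).1 (by rw [h]; exact u.isUnit))).symm
  rw [balancedInd, h, sum_sub_distrib, sum_const, nsmul_eq_mul, hc]
  field_simp

lemma abs_sum_balancedInd_le (D : ℕ) [NeZero D] (c : (ZMod D)ˣ) {a b : ℕ} (hab : a ≤ b) :
    |∑ l ∈ Ioc a b, balancedInd D c l| ≤ 2 := by
  have hφ : (0 : ℝ) < D.totient := by exact_mod_cast Nat.totient_pos.2 (NeZero.pos D)
  have hc : ((Finset.univ : Finset (ZMod D)ˣ).card : ℝ) = D.totient := by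
    rw [Finset.card_univ, ZMod.card_units_eq_totient]
  simp_rw [balancedInd_eq_sub_mean]
  rw [← sum_div, sum_comm, abs_div, abs_of_pos hφ, div_le_iff₀ hφ]
  refine (abs_sum_le_sum_abs _ _).trans ?_
  rw [mul_comm, ← hc, ← nsmul_eq_mul]
  refine sum_le_card_nsmul _ _ _ fun u _ => ?_
  rw [sum_sub_distrib]
  have h1 := abs_le.1 (abs_sum_ind_class_sub_le D (c : ZMod D) hab)
  have h2 := abs_le.1 (abs_sum_ind_class_sub_le D (u : ZMod D) hab)
  rw [abs_le]
  constructor <;> linarith [h1.1, h1.2, h2.1, h2.2]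

lemma abs_sum_balancedInd_mul_le (D : ℕ) [NeZero D] (c : (ZMod D)ˣ) (m : ℕ) {a b : ℕ}
    (hab : a ≤ b) : |∑ l ∈ Ioc a b, balancedInd D c (m * l)| ≤ 2 := by
  by_cases hm : m.Coprime D
  · obtain ⟨v, hv⟩ := (ZMod.isUnit_iff_coprime m D).2 hm
    have : ∀ l, balancedInd D c (m * l) = balancedInd D (v⁻¹ * c) l := fun l => by
      rw [balancedInd, balancedInd, Nat.cast_mul, ← hv, Units.val_mul]
      have h : (m * l).Coprime D ↔ l.Coprime D :=
        ⟨fun h => (Nat.coprime_mul_iff_left.1 h).2, fun h => Nat.coprime_mul_iff_left.2 ⟨hm, h⟩⟩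
      simp only [Units.eq_inv_mul_iff_mul_eq, h]
    simp_rw [this]
    exact abs_sum_balancedInd_le D _ hab
  · rw [sum_eq_zero, abs_zero]
    · norm_num
    intro l _
    have h1 : ¬ (m * l).Coprime D := fun h => hm (Nat.Coprime.coprime_mul_right h)
    rw [balancedInd, if_neg h1, if_neg]
    · simp
    · intro h
      exact h1 ((ZMod.isUnit_iff_coprime (m * l) D).1 (by rw [h]; exact c.isUnit))

lemma abs_balancedInd_le (D : ℕ) [NeZero D] (c : (ZMod D)ˣ) (n : ℕ) :
    |balancedInd D c n| ≤ 1 := by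
  have hφ : (1 : ℝ) ≤ D.totient := by exact_mod_cast Nat.totient_pos.2 (NeZero.pos D)
  have h0 : (0 : ℝ) ≤ 1 / D.totient := by positivity
  have h1 : (1 : ℝ) / D.totient ≤ 1 := by
    rw [div_le_one (by linarith)]; exact hφ
  rw [balancedInd, abs_le]
  split_ifs <;> constructor <;> linarith [zero_div (D.totient : ℝ)]

lemma abs_sum_log_mul_le {B : ℕ → ℝ} {C : ℝ} (y : ℕ)
    (hB : ∀ a ≤ y, |∑ l ∈ Ioc a y, B l| ≤ C) :
    |∑ l ∈ Ioc 0 y, Real.log l * B l| ≤ C * Real.log y := by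
  have hlog : ∀ l : ℕ, 1 ≤ l → Real.log l =
      ∑ j ∈ Ico 1 l, (Real.log (j + 1 : ℕ) - Real.log j) := fun l hl => by
    rw [sum_Ico_sub (fun j : ℕ => Real.log j) hl]; simp
  have hmono : ∀ j ∈ Ico 1 y, 0 ≤ Real.log (j + 1 : ℕ) - Real.log j := fun j hj => by
    have : 1 ≤ j := (mem_Ico.1 hj).1
    rw [sub_nonneg]
    exact Real.log_le_log (by exact_mod_cast this) (by push_cast; linarith)
  rcases Nat.eq_zero_or_pos y with rfl | hy
  · simp
  have h1 : ∑ l ∈ Ioc 0 y, Real.log l * B l =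
      ∑ j ∈ Ico 1 y, (Real.log (j + 1 : ℕ) - Real.log j) * ∑ l ∈ Ioc j y, B l := by
    simp_rw [mul_sum]
    rw [sum_congr rfl (fun l hl => by rw [hlog l (mem_Ioc.1 hl).1, sum_mul])]
    refine sum_comm' fun l j => ?_
    simp only [mem_Ioc, mem_Ico]
    omega
  rw [h1, hlog y hy, mul_sum]
  refine (abs_sum_le_sum_abs _ _).trans (sum_le_sum fun j hj => ?_)
  rw [abs_mul, abs_of_nonneg (hmono j hj), mul_comm]
  exact mul_le_mul_of_nonneg_right (hB j (mem_Ico.1 hj).2.le) (hmono j hj)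

open ArithmeticFunction in
lemma sum_arith_mul (F G : ArithmeticFunction ℝ) (K : ℕ → ℝ) (x : ℕ) :
    ∑ n ∈ range (x + 1), (F * G) n * K n = ∑ m ∈ range (x + 1), ∑ l ∈ range (x + 1),
      if m * l ≤ x then F m * G l * K (m * l) else 0 := by
  rw [← sum_product', ← sum_filter, range_eq_Ico, sum_eq_sum_Ico_succ_bot (by omega)]
  simp_rw [ArithmeticFunction.mul_apply, sum_mul]
  simp only [Nat.divisorsAntidiagonal_zero, sum_empty, zero_add]
  rw [sum_sigma']
  symm
  rw [← sum_filter_add_sum_filter_not _ (fun P : ℕ × ℕ => P.1 * P.2 = 0)]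
  rw [sum_eq_zero (s := filter _ _) (f := fun P : ℕ × ℕ => F P.1 * G P.2 * K (P.1 * P.2))
    (by
      intro P hP
      have := (mem_filter.1 hP).2
      rcases Nat.mul_eq_zero.1 this with h | h <;> simp [h]), zero_add]
  refine sum_bij' (fun P _ => ⟨P.1 * P.2, P⟩) (fun S _ => S.2) ?_ ?_ ?_ ?_ ?_
  · intro P hP
    simp only [mem_filter, mem_product, mem_Ico, mem_sigma, Nat.mem_divisorsAntidiagonal] at hP ⊢
    have := Nat.pos_of_ne_zero hP.2
    refine ⟨⟨by omega, by omega⟩, trivial, hP.2⟩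
  · rintro ⟨n, P⟩ hS
    simp only [mem_filter, mem_product, mem_Ico, mem_sigma, Nat.mem_divisorsAntidiagonal] at hS ⊢
    obtain ⟨h1, h2, h3⟩ := hS
    have hp : P.1 * P.2 ≠ 0 := by omega
    have a1 : 0 < P.1 := Nat.pos_of_ne_zero (left_ne_zero_of_mul hp)
    have a2 : 0 < P.2 := Nat.pos_of_ne_zero (right_ne_zero_of_mul hp)
    have b1 := Nat.le_mul_of_pos_right P.1 a2
    have b2 := Nat.le_mul_of_pos_left P.2 a1
    refine ⟨⟨⟨by omega, by omega⟩, by omega⟩, hp⟩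
  · intro P hP; rfl
  · rintro ⟨n, P⟩ hS
    simp only [mem_sigma, Nat.mem_divisorsAntidiagonal] at hS
    obtain ⟨h1, h2, h3⟩ := hS
    subst h2; rfl
  · intro P hP; rfl

section Vaughan

open ArithmeticFunction ArithmeticFunction.Moebius
open ArithmeticFunction.zeta

/-- The restriction of an arithmetic function to `[1, U]`. -/
def arithTrunc (U : ℕ) (F : ArithmeticFunction ℝ) : ArithmeticFunction ℝ :=
  ⟨fun n => if n ≤ U then F n else 0, by simp⟩

lemma arithTrunc_apply (U : ℕ) (F : ArithmeticFunction ℝ) (n : ℕ) :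
    arithTrunc U F n = if n ≤ U then F n else 0 := rfl

lemma vaughan_identity (U : ℕ) : (Λ : ArithmeticFunction ℝ) = arithTrunc U Λ +
    arithTrunc U (μ : ArithmeticFunction ℝ) * log -
    arithTrunc U (μ : ArithmeticFunction ℝ) * arithTrunc U Λ * (ζ : ArithmeticFunction ℝ) +
    ((μ : ArithmeticFunction ℝ) - arithTrunc U (μ : ArithmeticFunction ℝ)) *
      ((Λ - arithTrunc U Λ) * (ζ : ArithmeticFunction ℝ)) := by
  have h1 := coe_moebius_mul_coe_zeta (R := ℝ)
  have h2 := vonMangoldt_mul_zeta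
  linear_combination arithTrunc U (μ : ArithmeticFunction ℝ) * h2 +
    (arithTrunc U Λ - Λ) * h1

lemma abs_typeI_le {A G : ArithmeticFunction ℝ} {K : ℕ → ℝ} {x M : ℕ} {B C : ℝ} (hB : 0 ≤ B)
    (hA : ∀ m ∈ Icc 1 M, |A m| ≤ C) (hAM : ∀ m, M < m → A m = 0)
    (h : ∀ m y, y ≤ x → |∑ l ∈ Ioc 0 y, G l * K (m * l)| ≤ B) :
    |∑ n ∈ range (x + 1), (A * G) n * K n| ≤ M * C * B := by
  rw [sum_arith_mul]
  have h1 : ∀ m ∈ range (x + 1), m ≠ 0 → (∑ l ∈ range (x + 1),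
      if m * l ≤ x then A m * G l * K (m * l) else 0) =
      A m * ∑ l ∈ Ioc 0 (x / m), G l * K (m * l) := by
    intro m _ hm
    rw [← sum_filter, mul_sum]
    symm
    refine sum_subset_zero_on_sdiff ?_ ?_ ?_
    · intro l hl
      have hl' := (Nat.le_div_iff_mul_le (Nat.pos_of_ne_zero hm)).1 (mem_Ioc.1 hl).2
      have := (mem_Ioc.1 hl).2.trans (Nat.div_le_self x m)
      simp only [mem_filter, mem_range]
      exact ⟨by omega, by rwa [mul_comm]⟩
    · intro l hl
      simp only [mem_sdiff, mem_filter, mem_range, mem_Ioc, not_and] at hl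
      have h0 : l = 0 := by
        by_contra hl0
        refine hl.2 (Nat.pos_of_ne_zero hl0) ?_
        rw [Nat.le_div_iff_mul_le (Nat.pos_of_ne_zero hm), mul_comm]
        exact hl.1.2
      simp [h0]
    · intro l _; ring
  have h2 : ∑ m ∈ range (x + 1), |∑ l ∈ range (x + 1),
      if m * l ≤ x then A m * G l * K (m * l) else 0| ≤
      ∑ m ∈ range (x + 1), if m ∈ Icc 1 M then C * B else 0 := by
    refine sum_le_sum fun m hm => ?_
    rcases eq_or_ne m 0 with rfl | hm0
    · simp
    · rw [h1 m hm hm0, abs_mul]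
      split_ifs with hmM
      · have := hA m hmM
        exact mul_le_mul this (h m _ (Nat.div_le_self x m)) (abs_nonneg _)
          ((abs_nonneg _).trans this)
      · rw [hAM m]
        · simp
        · rw [mem_Icc] at hmM; omega
  refine (abs_sum_le_sum_abs _ _).trans (h2.trans ?_)
  rcases Nat.eq_zero_or_pos M with rfl | hM
  · simp
  have hC : 0 ≤ C := (abs_nonneg _).trans (hA 1 (mem_Icc.2 ⟨le_rfl, hM⟩))
  rw [← sum_filter, sum_const, nsmul_eq_mul, mul_assoc]
  refine mul_le_mul_of_nonneg_right ?_ (mul_nonneg hC hB)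
  have : ((range (x + 1)).filter (· ∈ Icc 1 M)).card ≤ (Icc 1 M).card :=
    card_le_card fun m hm => (mem_filter.1 hm).2
  rw [Nat.card_Icc] at this
  exact_mod_cast this

lemma abs_moebius_cast_le (m : ℕ) : |(μ : ArithmeticFunction ℝ) m| ≤ 1 := by
  rw [intCoe_apply]
  exact_mod_cast abs_moebius_le_one (n := m)

lemma abs_truncMoebius_le (U m : ℕ) : |arithTrunc U (μ : ArithmeticFunction ℝ) m| ≤ 1 := by
  rw [arithTrunc_apply]
  split_ifs
  · exact abs_moebius_cast_le m
  · simp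

lemma abs_sum_truncMangoldt_le {K : ℕ → ℝ} {x U : ℕ} (hK : ∀ n, |K n| ≤ 1) :
    |∑ n ∈ range (x + 1), arithTrunc U Λ n * K n| ≤ U * Real.log x := by
  have h2 : ∑ m ∈ range (x + 1), |arithTrunc U Λ m * K m| ≤
      ∑ m ∈ range (x + 1), if m ∈ Icc 1 U then Real.log x else 0 := by
    refine sum_le_sum fun m hm => ?_
    rw [arithTrunc_apply]
    rcases eq_or_ne m 0 with rfl | hm0
    · simp
    · have h1 : m ∈ Icc 1 U ↔ m ≤ U := by rw [mem_Icc]; omega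
      simp only [h1]
      split_ifs
      · rw [abs_mul, abs_of_nonneg vonMangoldt_nonneg]
        have h3 : Λ m ≤ Real.log x := vonMangoldt_le_log.trans
          (Real.log_le_log (by exact_mod_cast Nat.pos_of_ne_zero hm0)
            (by exact_mod_cast Nat.lt_succ_iff.1 (mem_range.1 hm)))
        exact (mul_le_of_le_one_right vonMangoldt_nonneg (hK m)).trans h3
      · simp
  refine (abs_sum_le_sum_abs _ _).trans (h2.trans ?_)
  rw [← sum_filter, sum_const, nsmul_eq_mul]
  refine mul_le_mul_of_nonneg_right ?_ (Real.log_natCast_nonneg x)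
  have : ((range (x + 1)).filter (· ∈ Icc 1 U)).card ≤ (Icc 1 U).card :=
    card_le_card fun m hm => (mem_filter.1 hm).2
  rw [Nat.card_Icc] at this
  exact_mod_cast this

lemma abs_truncMoebius_mul_truncMangoldt_le (U m : ℕ) :
    |(arithTrunc U (μ : ArithmeticFunction ℝ) * arithTrunc U Λ) m| ≤ Real.log m := by
  rw [ArithmeticFunction.mul_apply]
  refine (abs_sum_le_sum_abs _ _).trans ?_
  have : Real.log m = ∑ P ∈ m.divisorsAntidiagonal, Λ P.2 := by
    rw [← vonMangoldt_sum, ← Nat.sum_divisorsAntidiagonal' (fun _ b => Λ b)]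
  rw [this]
  refine sum_le_sum fun P _ => ?_
  rw [abs_mul]
  refine (mul_le_of_le_one_left (abs_nonneg _) (abs_truncMoebius_le U _)).trans ?_
  rw [arithTrunc_apply]
  split_ifs
  · rw [abs_of_nonneg vonMangoldt_nonneg]
  · simp

lemma truncMoebius_mul_truncMangoldt_eq_zero {U m : ℕ} (hm : U ^ 2 < m) :
    (arithTrunc U (μ : ArithmeticFunction ℝ) * arithTrunc U Λ) m = 0 := by
  rw [ArithmeticFunction.mul_apply]
  refine sum_eq_zero fun P hP => ?_
  have h := (Nat.mem_divisorsAntidiagonal.1 hP).1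
  rw [arithTrunc_apply, arithTrunc_apply]
  by_cases h1 : P.1 ≤ U
  · by_cases h2 : P.2 ≤ U
    · have := Nat.mul_le_mul h1 h2
      rw [h, ← sq] at this
      omega
    · rw [if_neg h2, mul_zero]
  · rw [if_neg h1, zero_mul]

lemma mangoldtTail_apply (U l : ℕ) :
    (((Λ : ArithmeticFunction ℝ) - arithTrunc U Λ) * (ζ : ArithmeticFunction ℝ)) l =
      ∑ d ∈ l.divisors, if d ≤ U then 0 else Λ d := by
  rw [ArithmeticFunction.coe_mul_zeta_apply]
  refine sum_congr rfl fun d _ => ?_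
  rw [sub_eq_add_neg, ArithmeticFunction.add_apply]
  change Λ d + -(arithTrunc U Λ d) = _
  rw [arithTrunc_apply]
  split_ifs <;> ring

lemma abs_mangoldtTail_le (U l : ℕ) :
    |(((Λ : ArithmeticFunction ℝ) - arithTrunc U Λ) * (ζ : ArithmeticFunction ℝ)) l| ≤
      Real.log l := by
  rw [mangoldtTail_apply, ← vonMangoldt_sum, abs_of_nonneg]
  · refine sum_le_sum fun d _ => ?_
    split_ifs
    · exact vonMangoldt_nonneg
    · exact le_rfl
  · refine sum_nonneg fun d _ => ?_
    split_ifs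
    · exact le_rfl
    · exact vonMangoldt_nonneg

lemma mangoldtTail_eq_zero {U l : ℕ} (hl : l ≤ U) :
    (((Λ : ArithmeticFunction ℝ) - arithTrunc U Λ) * (ζ : ArithmeticFunction ℝ)) l = 0 := by
  rw [mangoldtTail_apply]
  exact sum_eq_zero fun d hd => if_pos ((Nat.divisor_le hd).trans hl)

lemma moebiusTail_apply (U m : ℕ) :
    ((μ : ArithmeticFunction ℝ) - arithTrunc U (μ : ArithmeticFunction ℝ)) m =
      if m ≤ U then 0 else (μ : ArithmeticFunction ℝ) m := by
  rw [sub_eq_add_neg, ArithmeticFunction.add_apply]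
  change (μ : ArithmeticFunction ℝ) m + -(arithTrunc U (μ : ArithmeticFunction ℝ) m) = _
  rw [arithTrunc_apply]
  split_ifs <;> ring

lemma abs_sum_mangoldt_balancedInd_le (D : ℕ) [NeZero D] (c : (ZMod D)ˣ) {x U : ℕ} (hU : 1 ≤ U)
    (hUx : U ^ 2 ≤ x) :
    |∑ n ∈ range (x + 1), Λ n * balancedInd D c n| ≤ 5 * U ^ 2 * Real.log x +
      |∑ m ∈ range (x + 1), ∑ l ∈ range (x + 1), if m * l ≤ x then
        ((μ : ArithmeticFunction ℝ) - arithTrunc U (μ : ArithmeticFunction ℝ)) m *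
        (((Λ : ArithmeticFunction ℝ) - arithTrunc U Λ) * (ζ : ArithmeticFunction ℝ)) l *
        balancedInd D c (m * l) else 0| := by
  have hlog : 0 ≤ Real.log x := Real.log_natCast_nonneg x
  have hmono : ∀ y : ℕ, y ≤ x → Real.log y ≤ Real.log x := fun y hy => by
    rcases Nat.eq_zero_or_pos y with rfl | h
    · simpa using hlog
    · exact Real.log_le_log (by exact_mod_cast h) (by exact_mod_cast hy)
  have b1 : |∑ n ∈ range (x + 1), arithTrunc U Λ n * balancedInd D c n| ≤ U * Real.log x :=
    abs_sum_truncMangoldt_le (abs_balancedInd_le D c)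
  have b2 : |∑ n ∈ range (x + 1), (arithTrunc U (μ : ArithmeticFunction ℝ) * log) n *
      balancedInd D c n| ≤ U * 1 * (2 * Real.log x) := by
    refine abs_typeI_le (by positivity) (fun m _ => abs_truncMoebius_le U m) (fun m hm => ?_) ?_
    · rw [arithTrunc_apply, if_neg (by omega)]
    · intro m y hy
      refine (abs_sum_log_mul_le (B := fun l => balancedInd D c (m * l)) (C := 2) y
        fun a ha => abs_sum_balancedInd_mul_le D c m ha).trans ?_
      linarith [hmono y hy]
  have b3 : |∑ n ∈ range (x + 1), (arithTrunc U (μ : ArithmeticFunction ℝ) * arithTrunc U Λ *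
      (ζ : ArithmeticFunction ℝ)) n * balancedInd D c n| ≤
      (U ^ 2 : ℕ) * Real.log x * 2 := by
    refine abs_typeI_le (by positivity) (fun m hm => ?_)
      (fun m hm => truncMoebius_mul_truncMangoldt_eq_zero hm) ?_
    · exact (abs_truncMoebius_mul_truncMangoldt_le U m).trans
        (hmono m ((mem_Icc.1 hm).2.trans hUx))
    · intro m y hy
      rw [sum_congr rfl (g := fun l => balancedInd D c (m * l))]
      · exact abs_sum_balancedInd_mul_le D c m (Nat.zero_le y)
      · intro l hl
        have : l ≠ 0 := by have := (mem_Ioc.1 hl).1; omega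
        simp [natCoe_apply, zeta_apply, this]
  rw [← sum_arith_mul]
  have key : ∑ n ∈ range (x + 1), Λ n * balancedInd D c n =
      ∑ n ∈ range (x + 1), arithTrunc U Λ n * balancedInd D c n +
      ∑ n ∈ range (x + 1), (arithTrunc U (μ : ArithmeticFunction ℝ) * log) n *
        balancedInd D c n -
      ∑ n ∈ range (x + 1), (arithTrunc U (μ : ArithmeticFunction ℝ) * arithTrunc U Λ *
        (ζ : ArithmeticFunction ℝ)) n * balancedInd D c n +
      ∑ n ∈ range (x + 1), (((μ : ArithmeticFunction ℝ) -
        arithTrunc U (μ : ArithmeticFunction ℝ)) *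
        ((Λ - arithTrunc U Λ) * (ζ : ArithmeticFunction ℝ))) n * balancedInd D c n := by
    rw [← sum_add_distrib, ← sum_sub_distrib, ← sum_add_distrib]
    refine sum_congr rfl fun n _ => ?_
    have h := congrArg (fun F : ArithmeticFunction ℝ => F n) (vaughan_identity U)
    simp only [sub_eq_add_neg, ArithmeticFunction.add_apply, ArithmeticFunction.neg_apply] at h ⊢
    rw [h]
    ring
  rw [key]
  have hU' : (U : ℝ) ≤ (U : ℝ) ^ 2 := by
    have : (1 : ℝ) ≤ U := by exact_mod_cast hU
    nlinarith
  have hU'' := mul_le_mul_of_nonneg_right hU' hlog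
  refine (abs_add_le _ _).trans (add_le_add ?_ le_rfl)
  refine (abs_sub _ _).trans ?_
  refine (add_le_add (abs_add_le _ _) le_rfl).trans ?_
  push_cast at b3
  linarith

lemma sum_abs_mangoldt_balancedInd_le {𝒬 : Finset (ℕ × ℕ)} {z : ℕ} (h : PrimePairs 𝒬 z)
    (hz : 1 ≤ z) (c : ∀ P : ℕ × ℕ, (ZMod (P.1 * P.2))ˣ) {x U J : ℕ} (hU : 1 ≤ U)
    (hUx : U ^ 2 ≤ x) (hJ : x + 1 < 2 ^ J) :
    ∑ P ∈ 𝒬, ((P.1 * P.2 : ℕ) : ℝ) *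
      |∑ n ∈ range (x + 1), Λ n * balancedInd (P.1 * P.2) (c P) n| ≤
    𝒬.card * (z ^ 2 * (5 * U ^ 2 * Real.log x)) + (J : ℝ) ^ 2 * (48 * Real.log x *
      √(x * (4 * z ^ 2 * x + 6 * z ^ 5 * x / U + z ^ 8))) := by
  have hlog : 0 ≤ Real.log x := Real.log_natCast_nonneg x
  refine le_trans ?_ (add_le_add le_rfl (typeII_bound h hz c
    (fun m => ((μ : ArithmeticFunction ℝ) - arithTrunc U (μ : ArithmeticFunction ℝ)) m)
    (fun l => (((Λ : ArithmeticFunction ℝ) - arithTrunc U Λ) * (ζ : ArithmeticFunction ℝ)) l)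
    hU hJ ?_ ?_ ?_ ?_))
  · rw [← nsmul_eq_mul, ← sum_const, ← sum_add_distrib]
    refine sum_le_sum fun P hP => ?_
    have p1 := h.prime_fst P hP
    have p2 := h.prime_snd P hP
    have hne : P.1 * P.2 ≠ 0 := mul_ne_zero p1.ne_zero p2.ne_zero
    have : NeZero (P.1 * P.2) := ⟨hne⟩
    have hD : ((P.1 * P.2 : ℕ) : ℝ) ≤ (z : ℝ) ^ 2 := by
      have := Nat.mul_le_mul ((h.lt P hP).le.trans (h.le P hP)) (h.le P hP)
      rw [← sq] at this
      exact_mod_cast this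
    refine (mul_le_mul_of_nonneg_left (abs_sum_mangoldt_balancedInd_le _ (c P) hU hUx)
      (Nat.cast_nonneg _)).trans ?_
    rw [mul_add]
    exact add_le_add (mul_le_mul_of_nonneg_right hD (by positivity)) le_rfl
  · intro m
    simp only [moebiusTail_apply]
    split_ifs
    · simp
    · exact abs_moebius_cast_le m
  · intro l hl
    refine (abs_mangoldtTail_le U l).trans ?_
    rcases Nat.eq_zero_or_pos l with rfl | h
    · simpa using hlog
    · exact Real.log_le_log (by exact_mod_cast h) (by exact_mod_cast hl)
  · intro m hm
    simp only [moebiusTail_apply, if_pos hm]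
  · intro l hl
    exact mangoldtTail_eq_zero hl

end Vaughan

lemma exists_unit_crt {p q n : ℕ} (hp : p.Prime) (hq : q.Prime) (hpq : p ≠ q) (hpn : ¬ p ∣ n) :
    ∃ c : (ZMod (p * q))ˣ, ∀ r : ℕ, (r : ZMod (p * q)) = c → r ≡ n [MOD p] ∧ r ≡ 1 [MOD q] := by
  have hcop : p.Coprime q := (Nat.coprime_primes hp hq).2 hpq
  obtain ⟨m, hm1, hm2⟩ := Nat.chineseRemainder hcop n 1
  have h1 : m.Coprime p := by
    rw [Nat.Coprime, hm1.gcd_eq]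
    exact ((Nat.Prime.coprime_iff_not_dvd hp).2 hpn).symm
  have h2 : m.Coprime q := by
    rw [Nat.Coprime, hm2.gcd_eq, Nat.gcd_one_left]
  refine ⟨ZMod.unitOfCoprime m (Nat.Coprime.mul_right h1 h2), fun r hr => ?_⟩
  rw [ZMod.coe_unitOfCoprime, ZMod.natCast_eq_natCast_iff] at hr
  exact ⟨(hr.of_mul_right q).trans hm1, (hr.of_mul_left p).trans hm2⟩

lemma card_primeFactors_le_log {n : ℕ} (hn : n ≠ 0) :
    (n.primeFactors.card : ℝ) ≤ 2 * Real.log n := by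
  have h : 2 ^ n.primeFactors.card ≤ n := by
    refine le_trans ?_ (Nat.le_of_dvd (Nat.pos_of_ne_zero hn) (Nat.prod_primeFactors_dvd n))
    rw [← prod_const]
    exact prod_le_prod' fun p hp => (Nat.prime_of_mem_primeFactors hp).two_le
  have h' : ((2 : ℝ) ^ n.primeFactors.card) ≤ n := by exact_mod_cast h
  have := Real.log_le_log (by positivity) h'
  rw [Real.log_pow] at this
  have l2 := Real.log_two_gt_d9
  have : (n.primeFactors.card : ℝ) * (1 / 2) ≤ n.primeFactors.card * Real.log 2 :=
    mul_le_mul_of_nonneg_left (by linarith) (Nat.cast_nonneg _)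
  linarith

lemma sum_mangoldt_class_le {D : ℕ} [NeZero D] (u : ZMod D) {x Y : ℕ} (hx : 1 ≤ x)
    (h : ∀ r : ℕ, r.Prime → Y ≤ r → r ≤ x → (r : ZMod D) ≠ u) :
    ∑ n ∈ Ioc 0 x, (if (n : ZMod D) = u then ArithmeticFunction.vonMangoldt n else 0) ≤
      2 * √x * Real.log x + Real.log x * ((Y : ℝ) / D + 1) := by
  have hψ := Chebyshev.psi_sub_theta_le (x := x) (by exact_mod_cast hx)
  rw [Chebyshev.psi_sub_theta_eq_sum_not_prime, Nat.floor_natCast] at hψ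
  rw [← sum_filter_add_sum_filter_not _ (fun n : ℕ => ¬ n.Prime)]
  refine add_le_add (le_trans (sum_le_sum fun n _ => ?_) hψ) ?_
  · split_ifs
    · exact le_rfl
    · exact ArithmeticFunction.vonMangoldt_nonneg
  have hlog : 0 ≤ Real.log x := Real.log_natCast_nonneg x
  have h1 : ∑ n ∈ (Ioc 0 x).filter (fun n => ¬ ¬ n.Prime),
      (if (n : ZMod D) = u then ArithmeticFunction.vonMangoldt n else 0) ≤
      ∑ n ∈ Ioc 0 Y, Real.log x * (if (n : ZMod D) = u then (1 : ℝ) else 0) := by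
    rw [← mul_sum, ← sum_filter, filter_filter, ← sum_filter, sum_const, nsmul_eq_mul, mul_one,
      mul_comm]
    refine (sum_le_card_nsmul _ _ (Real.log x) fun n hn => ?_).trans ?_
    · obtain ⟨hn, -⟩ := mem_filter.1 hn
      exact ArithmeticFunction.vonMangoldt_le_log.trans (Real.log_le_log
        (by exact_mod_cast (mem_Ioc.1 hn).1) (by exact_mod_cast (mem_Ioc.1 hn).2))
    · rw [nsmul_eq_mul]
      refine mul_le_mul_of_nonneg_right ?_ hlog
      norm_cast
      refine card_le_card fun n hn => ?_
      simp only [mem_filter, mem_Ioc, not_not] at hn ⊢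
      refine ⟨⟨hn.1.1, ?_⟩, hn.2.2⟩
      by_contra hY
      exact h n hn.2.1 (by omega) hn.1.2 hn.2.2
  rw [← mul_sum] at h1
  refine h1.trans (mul_le_mul_of_nonneg_left ?_ hlog)
  have := (abs_le.1 (abs_sum_ind_class_sub_le D u (Nat.zero_le Y))).2
  rw [Nat.cast_zero, sub_zero] at this
  linarith

lemma le_sum_mangoldt_coprime {p q x : ℕ} (hp : p.Prime) (hq : q.Prime) :
    Chebyshev.theta x - 2 * Real.log x ≤
      ∑ n ∈ Ioc 0 x, if n.Coprime (p * q) then ArithmeticFunction.vonMangoldt n else 0 := by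
  have hlog : 0 ≤ Real.log x := Real.log_natCast_nonneg x
  rw [Chebyshev.theta_eq_sum_primesLE_log]
  have h1 : ∑ r ∈ x.primesLE, Real.log r ≤ ∑ r ∈ x.primesLE,
      ((if r.Coprime (p * q) then ArithmeticFunction.vonMangoldt r else 0) +
        ((if r = p then Real.log x else 0) + if r = q then Real.log x else 0)) := by
    refine sum_le_sum fun r hr => ?_
    obtain ⟨hrx, hr⟩ := Nat.mem_primesLE.1 hr
    have hlr : Real.log r ≤ Real.log x :=
      Real.log_le_log (by exact_mod_cast hr.pos) (by exact_mod_cast hrx)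
    by_cases h1 : r = p
    · rw [if_pos h1]
      have : 0 ≤ if r = q then Real.log x else 0 := by split_ifs <;> simp [hlog]
      have : 0 ≤ if r.Coprime (p * q) then ArithmeticFunction.vonMangoldt r else 0 := by
        split_ifs <;> simp
      linarith
    by_cases h2 : r = q
    · rw [if_pos h2, if_neg h1]
      have : 0 ≤ if r.Coprime (p * q) then ArithmeticFunction.vonMangoldt r else 0 := by
        split_ifs <;> simp
      linarith
    rw [if_pos (Nat.Coprime.mul_right ((Nat.coprime_primes hr hp).2 h1)
      ((Nat.coprime_primes hr hq).2 h2)), if_neg h1, if_neg h2,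
      ArithmeticFunction.vonMangoldt_apply_prime hr]
    simp
  rw [sum_add_distrib, sum_add_distrib, sum_ite_eq', sum_ite_eq'] at h1
  have h2 : ∑ r ∈ x.primesLE, (if r.Coprime (p * q) then ArithmeticFunction.vonMangoldt r else 0) ≤
      ∑ n ∈ Ioc 0 x, if n.Coprime (p * q) then ArithmeticFunction.vonMangoldt n else 0 := by
    refine sum_le_sum_of_subset_of_nonneg ?_ ?_
    · intro r hr
      obtain ⟨hrx, hr⟩ := Nat.mem_primesLE.1 hr
      exact mem_Ioc.2 ⟨hr.pos, hrx⟩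
    · intro n _ _
      split_ifs <;> simp
  have h3 : ∀ a : ℕ, (if a ∈ x.primesLE then Real.log x else 0) ≤ Real.log x := fun a => by
    split_ifs <;> simp [hlog]
  linarith [h3 p, h3 q]

lemma le_mul_abs_sum_mangoldt {p q x Y : ℕ} (hp : p.Prime) (hq : q.Prime) (hx : 2 ≤ x)
    (c : (ZMod (p * q))ˣ)
    (h : ∀ r : ℕ, r.Prime → Y ≤ r → r ≤ x → (r : ZMod (p * q)) ≠ c) :
    x * Real.log 2 - Real.log x * (9 * ((p * q : ℕ) * √x) + Y) ≤ ((p * q : ℕ) : ℝ) *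
      |∑ n ∈ range (x + 1), ArithmeticFunction.vonMangoldt n * balancedInd (p * q) c n| := by
  have hne : p * q ≠ 0 := mul_ne_zero hp.ne_zero hq.ne_zero
  have : NeZero (p * q) := ⟨hne⟩
  have hlog : 0 ≤ Real.log x := Real.log_natCast_nonneg x
  have hA := le_sum_mangoldt_coprime (x := x) hp hq
  have hB := sum_mangoldt_class_le (c : ZMod (p * q)) (by omega) h
  have hθ := Chebyshev.theta_ge x
  set A := ∑ n ∈ Ioc 0 x, if n.Coprime (p * q) then ArithmeticFunction.vonMangoldt n else 0 with hAdef
  set B := ∑ n ∈ Ioc 0 x, if (n : ZMod (p * q)) = c then ArithmeticFunction.vonMangoldt n else 0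
    with hBdef
  have hA0 : 0 ≤ A := sum_nonneg fun n _ => by split_ifs <;> simp
  have hφ : (0 : ℝ) < (p * q).totient := by exact_mod_cast Nat.totient_pos.2 (NeZero.pos _)
  have hφ' : (((p * q).totient : ℕ) : ℝ) ≤ ((p * q : ℕ) : ℝ) := by
    exact_mod_cast Nat.totient_le (p * q)
  have e : ∑ n ∈ range (x + 1), ArithmeticFunction.vonMangoldt n * balancedInd (p * q) c n =
      B - A / (p * q).totient := by
    rw [hAdef, hBdef, sum_div, ← sum_sub_distrib, range_eq_Ico, sum_eq_sum_Ico_succ_bot (by omega)]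
    simp only [ArithmeticFunction.map_zero, zero_mul, zero_add]
    refine sum_congr (by ext; simp; omega) fun n _ => ?_
    rw [balancedInd]
    split_ifs <;> simp <;> ring
  rw [e]
  set D : ℝ := ((p * q : ℕ) : ℝ) with hD
  have hD1 : 1 ≤ D := by
    rw [hD]; exact_mod_cast Nat.pos_of_ne_zero hne
  have h1 : A ≤ D * (A / (p * q).totient) := by
    rw [← mul_div_assoc, le_div_iff₀ hφ, mul_comm]
    exact mul_le_mul_of_nonneg_right hφ' hA0
  have h2 : D * (A / (p * q).totient) - D * B ≤ D * |B - A / (p * q).totient| := by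
    rw [← mul_sub]
    refine mul_le_mul_of_nonneg_left ?_ (by linarith)
    rw [abs_sub_comm]
    exact le_abs_self _
  have h3 : D * B ≤ 2 * (D * √x) * Real.log x + Real.log x * (Y + D) := by
    refine (mul_le_mul_of_nonneg_left hB (by linarith)).trans (le_of_eq ?_)
    field_simp
  have hx1 : (2 : ℝ) ≤ x := by exact_mod_cast hx
  have hs : 1 ≤ √(x : ℝ) := Real.one_le_sqrt.2 (by linarith)
  have h4 : Real.log (x + 1) ≤ 2 * Real.log x := by
    rw [← Real.log_rpow (by linarith)]
    refine Real.log_le_log (by linarith) ?_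
    norm_cast
    nlinarith
  have h5 : D ≤ D * √x := le_mul_of_one_le_right (by linarith) hs
  have h6 : √x ≤ D * √x := le_mul_of_one_le_left (by linarith) hD1
  have h7 := mul_le_mul_of_nonneg_right h5 hlog
  have h8 := mul_le_mul_of_nonneg_right h6 hlog
  have h9 := mul_le_mul_of_nonneg_right (hD1.trans h5) hlog
  nlinarith

lemma two_mul_card_offDiag_lt (s : Finset ℕ) :
    2 * (s.offDiag.filter (fun P => P.1 < P.2)).card = s.card * s.card - s.card := by
  have h1 := card_filter_add_card_filter_not (s := s.offDiag) (fun P : ℕ × ℕ => P.1 < P.2)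
  have h2 : (s.offDiag.filter (fun P => ¬ P.1 < P.2)).card =
      (s.offDiag.filter (fun P => P.1 < P.2)).card := by
    refine card_bij (fun P _ => P.swap) ?_ (fun P _ Q _ h => Prod.swap_injective h) ?_
    · intro P hP
      simp only [mem_filter, mem_offDiag, Prod.fst_swap, Prod.snd_swap] at hP ⊢
      exact ⟨⟨hP.1.2.1, hP.1.1, hP.1.2.2.symm⟩, by have := hP.1.2.2; omega⟩
    · intro P hP
      simp only [mem_filter, mem_offDiag] at hP
      refine ⟨P.swap, ?_, Prod.swap_swap P⟩
      simp only [mem_filter, mem_offDiag, Prod.fst_swap, Prod.snd_swap]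
      exact ⟨⟨hP.1.2.1, hP.1.1, hP.1.2.2.symm⟩, by omega⟩
  rw [offDiag_card] at h1
  omega

lemma card_primesLE_le (z W : ℕ) {n : ℕ} (hn : n ≠ 0) : z.primesLE.card ≤
    W + n.primeFactors.card + (z.primesLE.filter (fun p => W < p ∧ ¬ p ∣ n)).card := by
  have h : z.primesLE ⊆ (Ioc 0 W ∪ n.primeFactors) ∪
      z.primesLE.filter (fun p => W < p ∧ ¬ p ∣ n) := by
    intro p hp
    have hp' := (Nat.mem_primesLE.1 hp).2
    simp only [mem_union, mem_filter, mem_Ioc, Nat.mem_primeFactors]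
    by_cases h1 : W < p
    · by_cases h2 : p ∣ n
      · exact Or.inl (Or.inr ⟨hp', h2, hn⟩)
      · exact Or.inr ⟨hp, h1, h2⟩
    · exact Or.inl (Or.inl ⟨hp'.pos, by omega⟩)
  have h1 := card_le_card h
  have h2 := card_union_le (Ioc 0 W ∪ n.primeFactors)
    (z.primesLE.filter (fun p => W < p ∧ ¬ p ∣ n))
  have h3 := card_union_le (Ioc 0 W) n.primeFactors
  rw [Nat.card_Ioc] at h3
  omega

lemma le_card_filter_primesLE {n : ℕ} {A S L : ℝ} (hL : 1 ≤ L) (hS : 4000000 * L ^ 5 < S)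
    (hA : S ≤ A) (hn : (n : ℝ) = A ^ 4 * S ^ 16) (hlog : Real.log n = L) :
    A / (2 * L) ≤ ((⌊A⌋₊.primesLE.filter (fun p => ⌊A / S ^ 4⌋₊ < p ∧ ¬ p ∣ n)).card : ℝ) := by
  have hL1 : L ≤ L ^ 5 := le_self_pow₀ hL (by norm_num)
  have hL2 : L ^ 2 ≤ L ^ 5 := pow_le_pow_right₀ hL (by norm_num)
  have hS1 : 4000000 ≤ S := by linarith
  have hA0 : 0 < A := by linarith
  have hn0 : n ≠ 0 := by
    rintro rfl
    have : 0 < A ^ 4 * S ^ 16 := by positivity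
    rw [Nat.cast_zero] at hn
    linarith
  have h1 := card_primesLE_le ⌊A⌋₊ ⌊A / S ^ 4⌋₊ hn0
  rw [Nat.primesLE_card_eq_primeCounting] at h1
  have h1' : (⌊A⌋₊.primeCounting : ℝ) ≤ ⌊A / S ^ 4⌋₊ + n.primeFactors.card +
    (⌊A⌋₊.primesLE.filter (fun p => ⌊A / S ^ 4⌋₊ < p ∧ ¬ p ∣ n)).card := by exact_mod_cast h1
  have h2 := card_primeFactors_le_log hn0
  have h3 : (⌊A / S ^ 4⌋₊ : ℝ) ≤ A / S ^ 4 := Nat.floor_le (by positivity)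
  have h4 := Chebyshev.pi_ge ⌊A⌋₊
  have z1 : (⌊A⌋₊ : ℝ) ≤ A := Nat.floor_le hA0.le
  have z2 : A < ⌊A⌋₊ + 1 := Nat.lt_floor_add_one A
  have hAn : A + 1 ≤ n := by
    rw [hn]
    have e1 : A ≤ A ^ 4 := le_self_pow₀ (by linarith) (by norm_num)
    have e2 : S ≤ S ^ 16 := le_self_pow₀ (by linarith) (by norm_num)
    nlinarith
  have l1 : Real.log ⌊A⌋₊ ≤ L := by
    rw [← hlog]; exact Real.log_le_log (by linarith) (by linarith)
  have l2 : Real.log (⌊A⌋₊ + 1) ≤ L := by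
    rw [← hlog]; exact Real.log_le_log (by linarith) (by linarith)
  have l0 : 0 < Real.log ⌊A⌋₊ := Real.log_pos (by linarith)
  have ltwo := Real.log_two_gt_d9
  have h5 : (⌊A⌋₊ : ℝ) * (69 / 100) ≤ ⌊A⌋₊ * Real.log 2 :=
    mul_le_mul_of_nonneg_left (by linarith) (Nat.cast_nonneg _)
  have hAL : 4000000 * L ≤ A := by linarith
  have hAL2 : 4000000 * L ^ 2 ≤ A := by linarith
  have h6 : (⌊A⌋₊ * (69 / 100) - L) / L ≤ ⌊A⌋₊.primeCounting := by
    refine le_trans ?_ h4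
    refine div_le_div₀ ?_ ?_ l0 l1
    · linarith
    · linarith
  have h7 : A / S ^ 4 ≤ A / (100 * L) := by
    refine div_le_div_of_nonneg_left hA0.le (by linarith) ?_
    have : S ≤ S ^ 4 := le_self_pow₀ (by linarith) (by norm_num)
    linarith
  rw [sub_div, div_self (by linarith)] at h6
  have e1 : A / (100 * L) = A / L / 100 := by field_simp
  have e2 : A / (2 * L) = A / L / 2 := by field_simp
  have e3 : 4000000 * L ≤ A / L := by
    rw [le_div_iff₀ (by linarith)]; linarith
  have e4 : (A - 1) * (69 / 100) / L ≤ ⌊A⌋₊ * (69 / 100) / L := by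
    apply div_le_div_of_nonneg_right _ (by linarith)
    linarith
  have e5 : (A - 1) * (69 / 100) / L = A / L * (69 / 100) - (69 / 100) / L := by ring
  have e6 : (69 / 100) / L ≤ 1 := by rw [div_le_one (by linarith)]; linarith
  rw [hlog] at h2
  rw [e2]
  rw [e1] at h7
  linarith

set_option maxHeartbeats 1000000 in
lemma exists_good_prime {n : ℕ} {A S L : ℝ} (hL : 1 ≤ L) (hS : 4000000 * L ^ 5 < S)
    (hA : S ≤ A) (hn : (n : ℝ) = A ^ 4 * S ^ 16) (hlog : Real.log n = L) :
    ∃ p q r : ℕ, p.Prime ∧ q.Prime ∧ r.Prime ∧ A / S ^ 4 < p ∧ A / S ^ 4 < q ∧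
      A ^ 4 * S ^ 12 ≤ r ∧ 2 * r ≤ n ∧ r ≡ n [MOD p] ∧ r ≡ 1 [MOD q] := by
  classical
  have hL1 : L ≤ L ^ 5 := le_self_pow₀ hL (by norm_num)
  have hS1 : 4000000 ≤ S := by linarith
  have hS0 : 0 < S := by linarith
  have hA0 : 0 < A := by linarith
  have hA1 : 4000000 ≤ A := by linarith
  set z := ⌊A⌋₊ with hz
  set U := ⌊A * S ^ 2⌋₊ with hU
  set Y := ⌈A ^ 4 * S ^ 12⌉₊ with hY
  set x := n / 2 with hx
  set J := Nat.log 2 (x + 1) + 1 with hJ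
  set R := z.primesLE.filter (fun p => ⌊A / S ^ 4⌋₊ < p ∧ ¬ p ∣ n) with hR
  set 𝒬 := R.offDiag.filter (fun P => P.1 < P.2) with h𝒬
  have hK : A / (2 * L) ≤ (R.card : ℝ) := le_card_filter_primesLE hL hS hA hn hlog
  have hQcard := two_mul_card_offDiag_lt R
  rw [← h𝒬] at hQcard
  have hpow4 : S ≤ S ^ 4 := le_self_pow₀ (by linarith) (by norm_num)
  have hA4 : A ≤ A ^ 4 := le_self_pow₀ (by linarith) (by norm_num)
  have hS16 : S ≤ S ^ 16 := le_self_pow₀ (by linarith) (by norm_num)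
  have hS12 : S ≤ S ^ 12 := le_self_pow₀ (by linarith) (by norm_num)
  have hnbig : 4000000 * 4000000 ≤ (n : ℝ) := by
    rw [hn]; exact mul_le_mul (by linarith) (by linarith) (by norm_num) (by positivity)
  -- the number of pairs
  have hQ : A ^ 2 / (16 * L ^ 2) ≤ (𝒬.card : ℝ) := by
    have h2 : (2 : ℝ) ≤ R.card := by
      refine le_trans ?_ hK
      rw [le_div_iff₀ (by linarith)]
      linarith
    have h2' : 2 ≤ R.card := by exact_mod_cast h2
    have h3 : 2 * (𝒬.card : ℝ) = R.card * R.card - R.card := by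
      have : 2 * 𝒬.card + R.card = R.card * R.card := by
        have : R.card ≤ R.card * R.card := Nat.le_mul_self _
        omega
      have h' : 2 * (𝒬.card : ℝ) + R.card = R.card * R.card := by exact_mod_cast this
      linarith
    have h4 : (A / (2 * L)) ^ 2 ≤ (R.card : ℝ) ^ 2 := by gcongr
    have e : (A / (2 * L)) ^ 2 = 4 * (A ^ 2 / (16 * L ^ 2)) := by field_simp; ring
    nlinarith
  have hQ0 : 0 < (𝒬.card : ℝ) := lt_of_lt_of_le (by positivity) hQ
  have hpairs : PrimePairs 𝒬 z := by
    constructor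
    · intro P hP
      exact (Nat.mem_primesLE.1 (mem_filter.1 (mem_offDiag.1 (mem_filter.1 hP).1).1).1).2
    · intro P hP
      exact (Nat.mem_primesLE.1 (mem_filter.1 (mem_offDiag.1 (mem_filter.1 hP).1).2.1).1).2
    · intro P hP
      exact (mem_filter.1 hP).2
    · intro P hP
      exact (Nat.mem_primesLE.1 (mem_filter.1 (mem_offDiag.1 (mem_filter.1 hP).1).2.1).1).1
  have hcex : ∀ P : ℕ × ℕ, ∃ c : (ZMod (P.1 * P.2))ˣ, P ∈ 𝒬 → ∀ r : ℕ,
      (r : ZMod (P.1 * P.2)) = c → r ≡ n [MOD P.1] ∧ r ≡ 1 [MOD P.2] := by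
    intro P
    by_cases hP : P ∈ 𝒬
    · obtain ⟨c, hc⟩ := exists_unit_crt (n := n) (hpairs.prime_fst P hP) (hpairs.prime_snd P hP)
        (hpairs.lt P hP).ne (mem_filter.1 (mem_offDiag.1 (mem_filter.1 hP).1).1).2.2
      exact ⟨c, fun _ => hc⟩
    · exact ⟨1, fun h => absurd h hP⟩
  choose c hc using hcex
  by_contra hcon
  -- size estimates
  have zle : (z : ℝ) ≤ A := Nat.floor_le hA0.le
  have hz1 : 1 ≤ z := Nat.le_floor (by push_cast; linarith)
  have hAS : 1 ≤ A * S ^ 2 := one_le_mul_of_one_le_of_one_le (by linarith)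
    (one_le_pow₀ (by linarith))
  have Ule : (U : ℝ) ≤ A * S ^ 2 := Nat.floor_le (by linarith)
  have Uge : A * S ^ 2 / 2 ≤ U := by
    have : A * S ^ 2 < U + 1 := Nat.lt_floor_add_one _
    have : 2 ≤ A * S ^ 2 := by
      have : S ≤ S ^ 2 := le_self_pow₀ (by linarith) (by norm_num)
      nlinarith
    linarith
  have hU1 : 1 ≤ U := Nat.le_floor (by push_cast; linarith)
  have xle : 2 * (x : ℝ) ≤ n := by
    have : 2 * x ≤ n := by omega
    exact_mod_cast this
  have xge : (n : ℝ) ≤ 2 * x + 1 := by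
    have : n ≤ 2 * x + 1 := by omega
    exact_mod_cast this
  have hx2 : 2 ≤ x := by
    have : (2 : ℝ) ≤ x := by linarith
    exact_mod_cast this
  have hxL : Real.log x ≤ L := by
    rw [← hlog]
    exact Real.log_le_log (by linarith) (by linarith)
  have hxL0 : 0 ≤ Real.log x := Real.log_natCast_nonneg x
  have hUx : U ^ 2 ≤ x := by
    have h1 : (U : ℝ) ^ 2 ≤ (A * S ^ 2) ^ 2 := by gcongr
    have h2 : 4 * (A * S ^ 2) ^ 2 ≤ n := by
      have e : (n : ℝ) = (A * S ^ 2) ^ 2 * (A ^ 2 * S ^ 12) := by rw [hn]; ring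
      rw [e, mul_comm]
      refine mul_le_mul_of_nonneg_left ?_ (by positivity)
      nlinarith [le_self_pow₀ (show 1 ≤ A by linarith) (show 2 ≠ 0 by norm_num)]
    have : (U : ℝ) ^ 2 ≤ x := by linarith
    exact_mod_cast this
  have hJx : x + 1 < 2 ^ J := Nat.lt_pow_succ_log_self (by norm_num) _
  have hJL : (J : ℝ) ≤ 4 * L := by
    have h1 : 2 ^ Nat.log 2 (x + 1) ≤ x + 1 := Nat.pow_log_le_self 2 (by omega)
    have h2 : (2 : ℝ) ^ Nat.log 2 (x + 1) ≤ n := by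
      have : ((2 : ℝ) ^ Nat.log 2 (x + 1)) ≤ x + 1 := by exact_mod_cast h1
      linarith
    have h3 := Real.log_le_log (by positivity) h2
    rw [Real.log_pow, hlog] at h3
    have l2 := Real.log_two_gt_d9
    have h4 : (Nat.log 2 (x + 1) : ℝ) * (1 / 2) ≤ Nat.log 2 (x + 1) * Real.log 2 :=
      mul_le_mul_of_nonneg_left (by linarith) (Nat.cast_nonneg _)
    rw [hJ]; push_cast
    linarith
  have hYle : (Y : ℝ) ≤ 2 * (A ^ 4 * S ^ 12) := by
    have h1 : (Y : ℝ) < A ^ 4 * S ^ 12 + 1 := Nat.ceil_lt_add_one (by positivity)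
    have : 1 ≤ A ^ 4 * S ^ 12 := one_le_mul_of_one_le_of_one_le (one_le_pow₀ (by linarith))
      (one_le_pow₀ (by linarith))
    linarith
  have hsqrt : √(x : ℝ) ≤ A ^ 2 * S ^ 8 := by
    rw [Real.sqrt_le_left (by positivity)]
    have : (A ^ 2 * S ^ 8) ^ 2 = n := by rw [hn]; ring
    linarith
  -- lower bound for each pair
  have hlow : ∀ P ∈ 𝒬, (x : ℝ) / 2 ≤ ((P.1 * P.2 : ℕ) : ℝ) * |∑ n ∈ range (x + 1),
      ArithmeticFunction.vonMangoldt n * balancedInd (P.1 * P.2) (c P) n| := by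
    intro P hP
    have hp := hpairs.prime_fst P hP
    have hq := hpairs.prime_snd P hP
    have hpm := (mem_filter.1 (mem_offDiag.1 (mem_filter.1 hP).1).1).2.1
    have hqm := (mem_filter.1 (mem_offDiag.1 (mem_filter.1 hP).1).2.1).2.1
    refine le_trans ?_ (le_mul_abs_sum_mangoldt (Y := Y) hp hq hx2 (c P) ?_)
    · have hD : ((P.1 * P.2 : ℕ) : ℝ) ≤ A ^ 2 := by
        have := Nat.mul_le_mul ((hpairs.lt P hP).le.trans (hpairs.le P hP)) (hpairs.le P hP)
        have h' : ((P.1 * P.2 : ℕ) : ℝ) ≤ (z : ℝ) * z := by exact_mod_cast this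
        exact (h'.trans (mul_le_mul zle zle (Nat.cast_nonneg _) hA0.le)).trans_eq (sq A).symm
      have h1 : ((P.1 * P.2 : ℕ) : ℝ) * √x ≤ A ^ 2 * (A ^ 2 * S ^ 8) :=
        mul_le_mul hD hsqrt (Real.sqrt_nonneg _) (by positivity)
      have h2 : 9 * (A ^ 2 * (A ^ 2 * S ^ 8)) ≤ A ^ 4 * S ^ 12 := by
        have e : A ^ 4 * S ^ 12 = S ^ 4 * (A ^ 2 * (A ^ 2 * S ^ 8)) := by ring
        rw [e]
        exact mul_le_mul_of_nonneg_right (by linarith) (by positivity)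
      have h3 : Real.log x * (9 * (((P.1 * P.2 : ℕ) : ℝ) * √x) + Y) ≤
          L * (3 * (A ^ 4 * S ^ 12)) :=
        mul_le_mul hxL (by linarith) (by positivity) (by linarith)
      have h4 : 300 * (L * (A ^ 4 * S ^ 12)) ≤ n := by
        have e : (n : ℝ) = S ^ 4 * (A ^ 4 * S ^ 12) := by rw [hn]; ring
        rw [e, ← mul_assoc]
        exact mul_le_mul_of_nonneg_right (by linarith) (by positivity)
      have ltwo := Real.log_two_gt_d9
      have h5 : (x : ℝ) * (69 / 100) ≤ x * Real.log 2 :=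
        mul_le_mul_of_nonneg_left (by linarith) (Nat.cast_nonneg _)
      linarith
    · intro r hr hYr hrx hrc
      obtain ⟨h1, h2⟩ := hc P hP r hrc
      refine hcon ⟨P.1, P.2, r, hp, hq, hr, Nat.lt_of_floor_lt hpm, Nat.lt_of_floor_lt hqm,
        ?_, by omega, h1, h2⟩
      exact (Nat.le_ceil _).trans (by exact_mod_cast hYr)
  have hup := sum_abs_mangoldt_balancedInd_le hpairs hz1 c hU1 hUx hJx
  have hsum := card_nsmul_le_sum 𝒬 _ _ hlow
  rw [nsmul_eq_mul] at hsum
  -- upper bound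
  have hI : (z : ℝ) ^ 2 * (5 * U ^ 2 * Real.log x) ≤ x / 4 := by
    have h1 : (z : ℝ) ^ 2 * (5 * U ^ 2 * Real.log x) ≤ A ^ 2 * (5 * (A * S ^ 2) ^ 2 * L) := by
      gcongr
    have h2 : A ^ 2 * (5 * (A * S ^ 2) ^ 2 * L) = 5 * L * (A ^ 4 * S ^ 4) := by ring
    have h3 : 5 * L * (A ^ 4 * S ^ 4) * 100 ≤ n := by
      have e : (n : ℝ) = S ^ 12 * (A ^ 4 * S ^ 4) := by rw [hn]; ring
      have : 500 * L * (A ^ 4 * S ^ 4) ≤ S ^ 12 * (A ^ 4 * S ^ 4) :=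
        mul_le_mul_of_nonneg_right (by linarith) (by positivity)
      rw [e]
      linarith
    linarith
  have hxn : (x : ℝ) ≤ A ^ 4 * S ^ 16 := by rw [← hn]; linarith [Nat.cast_nonneg (α := ℝ) x]
  have hroot : √((x : ℝ) * (4 * z ^ 2 * x + 6 * z ^ 5 * x / U + z ^ 8)) ≤ 5 * (A ^ 6 * S ^ 15) := by
    rw [Real.sqrt_le_left (by positivity)]
    have hUpos : 0 < A * S ^ 2 / 2 := by positivity
    have h1 : (x : ℝ) * (4 * z ^ 2 * x + 6 * z ^ 5 * x / U + z ^ 8) ≤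
        (A ^ 4 * S ^ 16) * (4 * A ^ 2 * (A ^ 4 * S ^ 16) +
          6 * A ^ 5 * (A ^ 4 * S ^ 16) / (A * S ^ 2 / 2) + A ^ 8) := by
      gcongr
    refine h1.trans ?_
    have e1 : 6 * A ^ 5 * (A ^ 4 * S ^ 16) / (A * S ^ 2 / 2) = 12 * (A ^ 8 * S ^ 14) := by
      field_simp; ring
    have e2 : 4 * A ^ 2 * (A ^ 4 * S ^ 16) ≤ 4 * (A ^ 8 * S ^ 14) := by
      have h : S ^ 2 ≤ A ^ 2 := by gcongr
      have := mul_le_mul_of_nonneg_left h (show 0 ≤ 4 * (A ^ 6 * S ^ 14) by positivity)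
      nlinarith
    have e3 : A ^ 8 ≤ A ^ 8 * S ^ 14 :=
      le_mul_of_one_le_right (by positivity) (one_le_pow₀ (by linarith))
    rw [e1]
    have e4 : 4 * A ^ 2 * (A ^ 4 * S ^ 16) + 12 * (A ^ 8 * S ^ 14) + A ^ 8 ≤
      25 * (A ^ 8 * S ^ 14) := by
      have : 0 ≤ A ^ 8 * S ^ 14 := by positivity
      linarith
    refine (mul_le_mul_of_nonneg_left e4 (by positivity)).trans (le_of_eq ?_)
    ring
  have hII : (J : ℝ) ^ 2 * (48 * Real.log x *
      √((x : ℝ) * (4 * z ^ 2 * x + 6 * z ^ 5 * x / U + z ^ 8))) < 𝒬.card * (x / 4) := by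
    have h1 : (J : ℝ) ^ 2 * (48 * Real.log x *
        √((x : ℝ) * (4 * z ^ 2 * x + 6 * z ^ 5 * x / U + z ^ 8))) ≤
        (4 * L) ^ 2 * (48 * L * (5 * (A ^ 6 * S ^ 15))) := by gcongr
    have h2 : A ^ 2 / (16 * L ^ 2) * (A ^ 4 * S ^ 16 / 16) ≤ 𝒬.card * (x / 4) := by
      refine mul_le_mul hQ ?_ (by positivity) hQ0.le
      rw [← hn]
      linarith
    refine (h1.trans_lt ?_).trans_le h2
    have e : A ^ 2 / (16 * L ^ 2) * (A ^ 4 * S ^ 16 / 16) =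
      (A ^ 6 * S ^ 15) * S / (256 * L ^ 2) := by field_simp; ring
    rw [e, lt_div_iff₀ (by positivity)]
    have e' : (4 * L) ^ 2 * (48 * L * (5 * (A ^ 6 * S ^ 15))) * (256 * L ^ 2) =
      (A ^ 6 * S ^ 15) * (983040 * L ^ 5) := by ring
    rw [e']
    refine mul_lt_mul_of_pos_left ?_ (by positivity)
    have : 0 < L ^ 5 := by positivity
    linarith
  have hI' := mul_le_mul_of_nonneg_left hI hQ0.le
  linarith

end

/-- For every real `ε > 0` there exists `N` such that for all integers
`n ≥ N` there exist an integer `k ≥ 1` and primes `p, q, r` with `n = k·p + r`,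
`r ≡ 1 (mod q)`, and `min {p²·k, p·k·r, q·r} ≥ n^(5/4 − ε)`. -/
theorem evasive_f_lower_bound (ε : ℝ) (hε : 0 < ε) :
    ∃ N : ℕ, ∀ n : ℕ, N ≤ n →
      ∃ k p q r : ℕ, 1 ≤ k ∧ Nat.Prime p ∧ Nat.Prime q ∧ Nat.Prime r ∧
        n = k * p + r ∧ r % q = 1 % q ∧
        (n : ℝ) ^ ((5 : ℝ) / 4 - ε) ≤
          min (min ((p : ℝ) ^ 2 * k) ((p : ℝ) * k * r)) ((q : ℝ) * r) := by
  set δ : ℝ := min (ε / 3) (1 / 100) with hδ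
  have hδ0 : 0 < δ := lt_min (by linarith) (by norm_num)
  have hδ1 : δ ≤ 1 / 100 := min_le_right _ _
  have hδε : 3 * δ ≤ ε := by linarith [min_le_left (ε / 3) (1 / 100 : ℝ)]
  have hev : ∀ᶠ t : ℝ in Filter.atTop, 1 ≤ Real.log t ∧ 4000000 * Real.log t ^ 5 < t ^ (δ / 4) := by
    have h1 : ∀ᶠ t : ℝ in Filter.atTop, 1 ≤ Real.log t :=
      Real.tendsto_log_atTop.eventually_ge_atTop 1
    have h2 := (isLittleO_log_rpow_rpow_atTop (5 : ℝ) (show 0 < δ / 4 by linarith)).bound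
      (show (0 : ℝ) < 1 / 8000000 by norm_num)
    filter_upwards [h1, h2, Filter.eventually_gt_atTop 0] with t ht1 ht2 ht0
    refine ⟨ht1, ?_⟩
    have hp : 0 < t ^ (δ / 4) := Real.rpow_pos_of_pos ht0 _
    rw [Real.norm_of_nonneg (by positivity), Real.norm_of_nonneg hp.le] at ht2
    have : Real.log t ^ (5 : ℝ) = Real.log t ^ 5 := by exact_mod_cast Real.rpow_natCast _ 5
    rw [this] at ht2
    linarith
  obtain ⟨N, hN⟩ := Filter.eventually_atTop.1 (tendsto_natCast_atTop_atTop.eventually hev)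
  refine ⟨max N 1, fun n hn => ?_⟩
  obtain ⟨hL, hS⟩ := hN n (le_of_max_le_left hn)
  have hn1 : (1 : ℝ) ≤ n := by exact_mod_cast le_of_max_le_right hn
  have hn0 : (0 : ℝ) < n := by linarith
  set S : ℝ := (n : ℝ) ^ (δ / 4) with hSdef
  set A : ℝ := (n : ℝ) ^ (1 / 4 - δ) with hAdef
  have hS0 : 0 < S := Real.rpow_pos_of_pos hn0 _
  have hA0 : 0 < A := Real.rpow_pos_of_pos hn0 _
  have hSA : S ≤ A := Real.rpow_le_rpow_of_exponent_le hn1 (by linarith)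
  have hpow : ∀ a b : ℕ, A ^ a * S ^ b = (n : ℝ) ^ ((1 / 4 - δ) * a + δ / 4 * b) := fun a b => by
    rw [hAdef, hSdef, Real.rpow_add hn0, Real.rpow_mul hn0.le, Real.rpow_mul hn0.le,
      Real.rpow_natCast, Real.rpow_natCast]
  have hnAS : (n : ℝ) = A ^ 4 * S ^ 16 := by
    rw [hpow, show (1 / 4 - δ) * (4 : ℕ) + δ / 4 * (16 : ℕ) = 1 by push_cast; ring,
      Real.rpow_one]
  have hgoal : (n : ℝ) ^ ((5 : ℝ) / 4 - ε) ≤ A ^ 5 * S ^ 8 := by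
    rw [hpow]
    refine Real.rpow_le_rpow_of_exponent_le hn1 ?_
    push_cast
    linarith
  obtain ⟨p, q, r, hp, hq, hr, hpA, hqA, hrA, hrn, hrp, hrq⟩ :=
    exists_good_prime hL hS hSA hnAS rfl
  have hle : r ≤ n := by omega
  obtain ⟨k, hk⟩ := (Nat.modEq_iff_dvd' hle).1 hrp
  have hnk : n = k * p + r := by rw [mul_comm, ← hk]; omega
  have hk1 : 1 ≤ k := by
    rcases Nat.eq_zero_or_pos k with h | h
    · have := hr.pos
      rw [h, mul_zero] at hk
      omega
    · exact h
  have hpk : (n : ℝ) / 2 ≤ p * k := by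
    have h1 : n ≤ 2 * (p * k) := by rw [← hk]; omega
    have : (n : ℝ) ≤ 2 * (p * k) := by exact_mod_cast h1
    linarith
  have hS1 : 4000000 ≤ S := by
    have : (1 : ℝ) ≤ Real.log n ^ 5 := one_le_pow₀ hL
    linarith
  have hAS4 : 0 < A / S ^ 4 := by positivity
  have hr0 : 0 ≤ A ^ 4 * S ^ 12 := by positivity
  refine ⟨k, p, q, r, hk1, hp, hq, hr, hnk, hrq, hgoal.trans ?_⟩
  have hS4 : 2 ≤ S ^ 4 := le_trans (by linarith) (le_self_pow₀ (show 1 ≤ S by linarith) (by norm_num))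
  refine le_min (le_min ?_ ?_) ?_
  · have h : A / S ^ 4 * (A ^ 4 * S ^ 16 / 2) ≤ p * (p * k) :=
      mul_le_mul hpA.le (by rw [← hnAS]; exact hpk) (by positivity) (Nat.cast_nonneg _)
    have e : A / S ^ 4 * (A ^ 4 * S ^ 16 / 2) = A ^ 5 * S ^ 8 * (S ^ 4 / 2) := by
      field_simp
    have h' : A ^ 5 * S ^ 8 ≤ A ^ 5 * S ^ 8 * (S ^ 4 / 2) :=
      le_mul_of_one_le_right (by positivity) (by linarith)
    nlinarith
  · have h : A ^ 4 * S ^ 16 / 2 * (A ^ 4 * S ^ 12) ≤ p * k * r :=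
      mul_le_mul (by rw [← hnAS]; exact hpk) hrA hr0 (by positivity)
    have e : A ^ 4 * S ^ 16 / 2 * (A ^ 4 * S ^ 12) = A ^ 5 * S ^ 8 * (A ^ 3 * S ^ 16 * (S ^ 4 / 2)) := by
      ring
    have h' : A ^ 5 * S ^ 8 ≤ A ^ 5 * S ^ 8 * (A ^ 3 * S ^ 16 * (S ^ 4 / 2)) := by
      refine le_mul_of_one_le_right (by positivity) (one_le_mul_of_one_le_of_one_le
        (one_le_mul_of_one_le_of_one_le (one_le_pow₀ (by linarith)) (one_le_pow₀ (by linarith)))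
        (by linarith))
    linarith
  · have h : A / S ^ 4 * (A ^ 4 * S ^ 12) ≤ q * r := mul_le_mul hqA.le hrA hr0 (Nat.cast_nonneg _)
    have e : A / S ^ 4 * (A ^ 4 * S ^ 12) = A ^ 5 * S ^ 8 := by field_simp
    linarith
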